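/- arXiv:2309.14128 — 2 statements merged into one kernel-verified Lean document; each statement's English description precedes it below -/
import Mathlib

section
/- Let (A, Tⁿ) be a spanning toric hyperplane arrangement in general position with |A| ≥ n. Then for every 0 ≤ k ≤ n there is a bijection Σ_k(A) ≅ Σ_{n−k}(A); in particular the f-vector of A is symmetric: f_k(A) = f_{n−k}(A) for all 0 ≤ k ≤ n. -/
open Set

/-- The `n`-torus `ℝⁿ/ℤⁿ`, modelled as a product of circles `ℝ/ℤ`. -/
abbrev Torus (n : ℕ) := Fin n → AddCircle (1 : ℝ)

/-- The group homomorphism `Tⁿ → ℝ/ℤ` induced by `x ↦ a₁x₁ + ⋯ + aₙxₙ`. -/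
noncomputable def theta {n : ℕ} (a : Fin n → ℤ) (x : Torus n) : AddCircle (1 : ℝ) :=
  ∑ i, a i • x i

/-- The affine toric hyperplane with normal vector `a` and intercept `c`. -/
def Hyp {n : ℕ} (a : Fin n → ℤ) (c : AddCircle (1 : ℝ)) : Set (Torus n) :=
  {x | theta a x = c}

/-- The set of connected components of a subset `A` of a topological space. -/
def comps {X : Type*} [TopologicalSpace X] (A : Set X) : Set (Set X) :=
  {C | ∃ x ∈ A, C = connectedComponentIn A x}

/-- The set `Σ_k` of `k`-flats of an arrangement of hypersurfaces `K i` inside an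
ambient space `W` of dimension `d`: `Σ_0` is the set of connected components of the
union over `d`-element index sets `S` of `⋂_{i ∈ S} K i`; for `0 < k < d`, `Σ_k` is the
union over `(d-k)`-element index sets `S` of the sets of connected components of
`⋂_{i ∈ S} K i` minus all lower-dimensional flats; and `Σ_d` is the set of connected
components of the complement `W \ ⋃ᵢ K i`. -/
noncomputable def SigIn {X : Type*} [TopologicalSpace X] {ι : Type*} [Fintype ι]
    (W : Set X) (d : ℕ) (K : ι → Set X) : ℕ → Set (Set X) := fun k =>
  Nat.strongRecOn k (fun k ih =>
    if k = 0 then comps (⋃ S ∈ {S : Finset ι | S.card = d}, ⋂ i ∈ S, K i)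
    else if k = d then comps (W \ ⋃ i, K i)
    else ⋃ S ∈ {S : Finset ι | S.card = d - k},
      comps ((⋂ i ∈ S, K i) \ ⋃ j : Fin k, ⋃ σ ∈ ih j j.isLt, σ))

/-- An arrangement (given by normal vectors `a`) is spanning if some `n` of the normal
vectors are linearly independent over `ℚ`. -/
def Spanning {ι : Type*} [Fintype ι] {n : ℕ} (a : ι → Fin n → ℤ) : Prop :=
  ∃ s : Finset ι, s.card = n ∧
    LinearIndependent ℚ (fun i : s => fun j => (a i.1 j : ℚ))

/-- An arrangement is in general position if for every subset `S` of hyperplanes with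
nonempty intersection, the corresponding normal vectors are linearly independent over `ℚ`. -/
def GenPos {ι : Type*} [Fintype ι] {n : ℕ} (a : ι → Fin n → ℤ)
    (b : ι → AddCircle (1 : ℝ)) : Prop :=
  ∀ S : Finset ι, (⋂ i ∈ S, Hyp (a i) (b i)).Nonempty →
    LinearIndependent ℚ (fun i : S => fun j => (a i.1 j : ℚ))

open Filter Topology

theorem floor_lt_self_lt_ceil {t : ℝ} (h : ¬ ∃ z : ℤ, t = z) :
    (⌊t⌋ : ℝ) < t ∧ t < ⌈t⌉ ∧ ⌈t⌉ = ⌊t⌋ + 1 := by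
  have h1 : (⌊t⌋ : ℝ) < t := lt_of_le_of_ne (Int.floor_le t) fun h' => h ⟨_, h'.symm⟩
  have h2 : t < ⌈t⌉ := lt_of_le_of_ne (Int.le_ceil t) fun h' => h ⟨_, h'⟩
  refine ⟨h1, h2, ?_⟩
  rw [Int.ceil_eq_iff]
  push_cast
  constructor <;> linarith [Int.lt_floor_add_one t]

theorem floor_ceil_of_between {t : ℝ} {z : ℤ} (h1 : (z : ℝ) < t) (h2 : t < z + 1) :
    ⌊t⌋ = z ∧ ⌈t⌉ = z + 1 ∧ ¬ ∃ w : ℤ, t = w := by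
  refine ⟨Int.floor_eq_iff.2 ⟨h1.le, h2⟩, Int.ceil_eq_iff.2 ⟨by push_cast; linarith,
    by push_cast; linarith⟩, ?_⟩
  rintro ⟨w, rfl⟩
  have h1 : z < w := by exact_mod_cast h1
  have h2 : w < z + 1 := by exact_mod_cast h2
  omega

/-! ### Cells of the periodic arrangement `⋃ i, {x | g i x - β i ∈ ℤ}` -/

section Periodic

variable {E ι : Type*} [AddCommGroup E] [Module ℝ E] (g : ι → E →ₗ[ℝ] ℝ) (β : ι → ℝ)

/-- The `i`-th affine form of the periodic arrangement. -/
def level (i : ι) (x : E) : ℝ := g i x - β i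

theorem level_add (i : ι) (x w : E) : level g β i (x + w) = level g β i x + g i w := by
  simp only [level, map_add]; ring

theorem level_eq_add_sub (i : ι) (x y : E) :
    level g β i x = level g β i y + g i (x - y) := by
  simp only [level, map_sub]; ring

/-- The index set of the walls through `x`. -/
noncomputable def walls [Fintype ι] (x : E) : Finset ι :=
  open Classical in {i | ∃ z : ℤ, level g β i x = z}

/-- The relatively open cell containing `x`. -/
def cell (x : E) : Set E :=
  {y | ∀ i, ⌊level g β i y⌋ = ⌊level g β i x⌋ ∧ ⌈level g β i y⌉ = ⌈level g β i x⌉}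

/-- The closure of the cell containing `x`. -/
def closedCell (x : E) : Set E :=
  {y | ∀ i, (⌊level g β i x⌋ : ℝ) ≤ level g β i y ∧ level g β i y ≤ ⌈level g β i x⌉}

/-- `y` minimizes `ξ` on the closed cell of `x`. -/
def IsBottom (ξ : E →ₗ[ℝ] ℝ) (x y : E) : Prop :=
  y ∈ closedCell g β x ∧ ∀ z ∈ closedCell g β x, ξ y ≤ ξ z

/-- `e` restricted to `J` is a basis dual to the forms `g i`, `i ∈ J`. -/
def IsDualFrame (J : Finset ι) (e : ι → E) : Prop :=
  (∀ i ∈ J, ∀ j ∈ J, i ≠ j → g i (e j) = 0) ∧ (∀ i ∈ J, g i (e i) = 1) ∧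
    ∀ w, w = ∑ j ∈ J, g j w • e j

/-- `ξ` does not vanish on any nonzero subspace cut out by some of the forms `g i`. -/
def IsGeneric (ξ : E →ₗ[ℝ] ℝ) : Prop :=
  ∀ J : Finset ι, (∃ w, w ≠ 0 ∧ ∀ i ∈ J, g i w = 0) → ∃ w, (∀ i ∈ J, g i w = 0) ∧ ξ w ≠ 0

variable {g β}

theorem mem_closedCell_self (x : E) : x ∈ closedCell g β x :=
  fun _ => ⟨Int.floor_le _, Int.le_ceil _⟩

theorem mem_cell_self (x : E) : x ∈ cell g β x := fun _ => ⟨rfl, rfl⟩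

theorem cell_eq_of_mem {x y : E} (h : y ∈ cell g β x) : cell g β y = cell g β x := by
  ext z
  simp only [cell, mem_ofPred_eq] at h ⊢
  exact forall_congr' fun i => by rw [(h i).1, (h i).2]

theorem closedCell_eq_of_mem {x y : E} (h : y ∈ cell g β x) :
    closedCell g β y = closedCell g β x := by
  ext z
  simp only [cell, closedCell, mem_ofPred_eq] at h ⊢
  exact forall_congr' fun i => by rw [(h i).1, (h i).2]

theorem exists_isGeneric [FiniteDimensional ℝ E] [Finite ι] :
    ∃ ξ : E →ₗ[ℝ] ℝ, IsGeneric g ξ := by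
  classical
  let T := {J : Finset ι // ∃ w, w ≠ 0 ∧ ∀ i ∈ J, g i w = 0}
  obtain ⟨ξ, hξ⟩ := Module.exists_dual_forall_apply_ne_zero (K := ℝ)
    (fun J : T => J.2.choose) fun J => J.2.choose_spec.1
  exact ⟨ξ, fun J hJ => ⟨hJ.choose, hJ.choose_spec.2, hξ ⟨J, hJ⟩⟩⟩

theorem IsDualFrame.apply_ne_zero {J : Finset ι} {e : ι → E} (he : IsDualFrame g J e)
    {ξ : E →ₗ[ℝ] ℝ} (hξ : IsGeneric g ξ) {j : ι} (hj : j ∈ J) : ξ (e j) ≠ 0 := by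
  classical
  obtain ⟨w, hw, hw0⟩ := hξ (J.erase j) ⟨e j, fun h => by
    have := he.2.1 j hj; simp [h] at this, fun i hi =>
    he.1 i (Finset.mem_of_mem_erase hi) j hj (Finset.ne_of_mem_erase hi)⟩
  intro h
  apply hw0
  rw [he.2.2 w, Finset.sum_eq_single_of_mem j hj, map_smul, h, smul_zero]
  intro i hi hij
  rw [hw i (Finset.mem_erase.2 ⟨hij, hi⟩), zero_smul]

theorem IsDualFrame.eq_zero {J : Finset ι} {e : ι → E} (he : IsDualFrame g J e) {w : E}
    (hw : ∀ j ∈ J, g j w = 0) : w = 0 := by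
  rw [he.2.2 w]
  exact Finset.sum_eq_zero fun j hj => by rw [hw j hj, zero_smul]

theorem IsDualFrame.apply_eq {J : Finset ι} {e : ι → E} (he : IsDualFrame g J e)
    (ξ : E →ₗ[ℝ] ℝ) (w : E) : ξ w = ∑ j ∈ J, g j w * ξ (e j) := by
  conv_lhs => rw [he.2.2 w]
  simp

variable [Fintype ι]

theorem mem_walls {x : E} {i : ι} : i ∈ walls g β x ↔ ∃ z : ℤ, level g β i x = z := by
  simp [walls]

theorem walls_eq_of_mem_cell {x y : E} (h : y ∈ cell g β x) : walls g β y = walls g β x := by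
  have key : ∀ {x y : E}, y ∈ cell g β x → ∀ i ∈ walls g β x, i ∈ walls g β y := by
    intro x y h i hi
    obtain ⟨z, hz⟩ := mem_walls.1 hi
    refine mem_walls.2 ⟨z, ?_⟩
    have := h i
    rw [hz, Int.floor_intCast, Int.ceil_intCast] at this
    exact le_antisymm (by simpa [this.2] using Int.le_ceil (level g β i y))
      (by simpa [this.1] using Int.floor_le (level g β i y))
  have hx : x ∈ cell g β y := by rw [cell_eq_of_mem h]; exact mem_cell_self x
  exact Finset.ext fun i => ⟨key hx i, key h i⟩

theorem level_eq_of_mem_closedCell {x y : E} (h : y ∈ closedCell g β x) {i : ι}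
    (hi : i ∈ walls g β x) : level g β i y = level g β i x := by
  obtain ⟨z, hz⟩ := mem_walls.1 hi
  have := h i
  rw [hz, Int.floor_intCast, Int.ceil_intCast] at this
  rw [hz]
  exact le_antisymm this.2 this.1

theorem walls_subset_of_mem_closedCell {x y : E} (h : y ∈ closedCell g β x) :
    walls g β x ⊆ walls g β y := fun i hi => by
  rw [mem_walls, level_eq_of_mem_closedCell h hi]
  exact mem_walls.1 hi

theorem mem_cell_of_walls {x y : E} (h1 : ∀ i ∈ walls g β x, level g β i y = level g β i x)
    (h2 : ∀ i ∉ walls g β x, (⌊level g β i x⌋ : ℝ) < level g β i y ∧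
      level g β i y < ⌈level g β i x⌉) : y ∈ cell g β x := by
  intro i
  by_cases hi : i ∈ walls g β x
  · rw [h1 i hi]; exact ⟨rfl, rfl⟩
  · have h3 := floor_lt_self_lt_ceil (mt mem_walls.2 hi)
    obtain ⟨h4, h5⟩ := h2 i hi
    rw [h3.2.2]
    rw [h3.2.2] at h5
    push_cast at h5
    have := floor_ceil_of_between h4 h5
    exact ⟨this.1, this.2.1⟩

/-- For a point of the closed cell of `x` not on the wall `i`, the `i`-th slab is that of `x`. -/
theorem floor_ceil_eq_of_not_mem_walls {x y : E} (h : y ∈ closedCell g β x) {i : ι}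
    (hi : i ∉ walls g β y) : ⌊level g β i x⌋ = ⌊level g β i y⌋ ∧
      ⌈level g β i x⌉ = ⌈level g β i y⌉ := by
  have hx : i ∉ walls g β x := fun h' => hi (walls_subset_of_mem_closedCell h h')
  have h3 := floor_lt_self_lt_ceil (mt mem_walls.2 hx)
  have h4 := h i
  have h5 : (⌊level g β i x⌋ : ℝ) < level g β i y :=
    lt_of_le_of_ne h4.1 fun h' => hi (mem_walls.2 ⟨_, h'.symm⟩)
  have h6 : level g β i y < ⌈level g β i x⌉ :=
    lt_of_le_of_ne h4.2 fun h' => hi (mem_walls.2 ⟨_, h'⟩)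
  rw [h3.2.2] at h6 ⊢
  push_cast at h6
  have := floor_ceil_of_between h5 h6
  exact ⟨this.1.symm, this.2.1.symm⟩

theorem eventually_mem_Ioo_add_mul {a b t c : ℝ} (h1 : a < t) (h2 : t < b) :
    ∀ᶠ s in 𝓝[>] (0 : ℝ), a < t + s * c ∧ t + s * c < b := by
  have h : Tendsto (fun s : ℝ => t + s * c) (𝓝[>] 0) (𝓝 t) := by
    have : ContinuousAt (fun s : ℝ => t + s * c) 0 := by fun_prop
    simpa [ContinuousAt] using this.tendsto.mono_left nhdsWithin_le_nhds
  exact h.eventually (Ioo_mem_nhds h1 h2)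

theorem IsBottom.apply_nonneg {ξ : E →ₗ[ℝ] ℝ} {x y w : E} (h : IsBottom g β ξ x y)
    (hw : ∀ i ∈ walls g β y, (⌊level g β i x⌋ : ℝ) ≤ level g β i y + g i w ∧
      level g β i y + g i w ≤ ⌈level g β i x⌉) : 0 ≤ ξ w := by
  have h1 : ∀ᶠ s in 𝓝[>] (0 : ℝ), y + s • w ∈ closedCell g β x := by
    refine eventually_all.2 fun i => ?_
    simp only [level_add, map_smul, smul_eq_mul]
    by_cases hi : i ∈ walls g β y
    · filter_upwards [Ioo_mem_nhdsGT (zero_lt_one' ℝ)] with s hs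
      obtain ⟨h1, h2⟩ := hw i hi
      obtain ⟨h3, h4⟩ := h.1 i
      constructor <;> nlinarith [hs.1, hs.2]
    · obtain ⟨h3, h4⟩ := floor_ceil_eq_of_not_mem_walls h.1 hi
      obtain ⟨h5, h6, -⟩ := floor_lt_self_lt_ceil (mt mem_walls.2 hi)
      rw [h3, h4]
      exact (eventually_mem_Ioo_add_mul h5 h6).mono fun s hs => ⟨hs.1.le, hs.2.le⟩
  obtain ⟨s, hs, hs0⟩ := (h1.and self_mem_nhdsWithin).exists
  have := h.2 _ hs
  rw [map_add, map_smul, smul_eq_mul] at this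
  have hs0 : 0 < s := hs0
  by_contra! hneg
  nlinarith [mul_neg_of_pos_of_neg hs0 hneg]

theorem IsBottom.apply_mul_nonneg {ξ : E →ₗ[ℝ] ℝ} {x y z : E} (h : IsBottom g β ξ x y)
    (hz : z ∈ closedCell g β x) {e : ι → E} (he : IsDualFrame g (walls g β y) e) {j : ι}
    (hj : j ∈ walls g β y) : 0 ≤ g j (z - y) * ξ (e j) := by
  rw [← smul_eq_mul, ← map_smul]
  refine h.apply_nonneg fun i hi => ?_
  rw [map_smul, smul_eq_mul]
  rcases eq_or_ne i j with rfl | hij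
  · rw [he.2.1 i hj, mul_one, ← level_eq_add_sub]
    exact hz i
  · rw [he.1 i hi j hj hij, mul_zero, add_zero]
    exact h.1 i

theorem IsBottom.eq_of_le {ξ : E →ₗ[ℝ] ℝ} (hξ : IsGeneric g ξ) {x y z : E}
    (h : IsBottom g β ξ x y) (hz : z ∈ closedCell g β x) {e : ι → E}
    (he : IsDualFrame g (walls g β y) e) (hle : ξ z ≤ ξ y) : z = y := by
  have h1 : ξ (z - y) ≤ 0 := by rw [map_sub]; linarith
  rw [he.apply_eq] at h1
  have h0 := fun j (hj : j ∈ walls g β y) => h.apply_mul_nonneg hz he hj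
  have h2 := (Finset.sum_eq_zero_iff_of_nonneg h0).1 (le_antisymm h1 (Finset.sum_nonneg h0))
  refine sub_eq_zero.1 (he.eq_zero fun j hj => ?_)
  exact (mul_eq_zero.1 (h2 j hj)).resolve_right (he.apply_ne_zero hξ hj)

theorem mem_cell_of_isBottom {ξ : E →ₗ[ℝ] ℝ} (hξ : IsGeneric g ξ) {x x' y : E}
    (h : IsBottom g β ξ x y) (h' : IsBottom g β ξ x' y) {e : ι → E}
    (he : IsDualFrame g (walls g β y) e) (hw : walls g β x' = walls g β x) :
    x' ∈ cell g β x := by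
  intro i
  by_cases hy : i ∈ walls g β y
  · by_cases hi : i ∈ walls g β x
    · rw [← level_eq_of_mem_closedCell h.1 hi, level_eq_of_mem_closedCell h'.1 (hw ▸ hi)]
      exact ⟨rfl, rfl⟩
    · obtain ⟨z, hz⟩ := mem_walls.1 hy
      have sgn : ∀ {x : E}, IsBottom g β ξ x y → i ∉ walls g β x →
          0 < (level g β i x - z) * ξ (e i) := by
        intro x h hi
        have h1 := h.apply_mul_nonneg (mem_closedCell_self x) he hy
        have h2 : g i (x - y) = level g β i x - z := by
          rw [level_eq_add_sub g β i x y, hz]; ring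
        rw [h2] at h1
        refine lt_of_le_of_ne h1 (Ne.symm (mul_ne_zero ?_ (he.apply_ne_zero hξ hy)))
        exact fun h3 => hi (mem_walls.2 ⟨z, sub_eq_zero.1 h3⟩)
      have slab : ∀ {x : E}, IsBottom g β ξ x y → i ∉ walls g β x →
          ⌈level g β i x⌉ = ⌊level g β i x⌋ + 1 ∧ (⌊level g β i x⌋ : ℝ) < level g β i x ∧
          level g β i x < ⌊level g β i x⌋ + 1 ∧ ⌊level g β i x⌋ ≤ z ∧
          z ≤ ⌊level g β i x⌋ + 1 := by
        intro x h hi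
        obtain ⟨h1, h2, h3⟩ := floor_lt_self_lt_ceil (mt mem_walls.2 hi)
        have h4 := h.1 i
        rw [hz, h3] at h4
        rw [h3] at h2
        exact ⟨h3, h1, by exact_mod_cast h2, by exact_mod_cast h4.1, by exact_mod_cast h4.2⟩
      have hi' : i ∉ walls g β x' := hw ▸ hi
      have s1 := sgn h hi
      have s2 := sgn h' hi'
      obtain ⟨a1, a2, a3, a4, a5⟩ := slab h hi
      obtain ⟨b1, b2, b3, b4, b5⟩ := slab h' hi'
      suffices ⌊level g β i x'⌋ = ⌊level g β i x⌋ from ⟨this, by rw [a1, b1, this]⟩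
      have key : ∀ {p q : ℤ} {s t : ℝ}, (p : ℝ) < s → s < p + 1 → p ≤ z → z ≤ p + 1 →
          (q : ℝ) < t → t < q + 1 → q ≤ z → z ≤ q + 1 → 0 < (s - z) * ξ (e i) →
          0 < (t - z) * ξ (e i) → p ≤ q := by
        intro p q s t h1 h2 h3 h4 h5 h6 h7 h8 h9 h10
        by_contra! hlt
        have hp : p = z := by omega
        have hq : q + 1 = z := by omega
        have hq' : (q : ℝ) + 1 = z := by exact_mod_cast hq
        subst hp
        have : 0 < ξ (e i) := by
          by_contra! hc
          nlinarith [mul_nonpos_of_nonneg_of_nonpos (sub_pos.2 h1).le hc]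
        nlinarith [mul_pos (sub_pos.2 h6) this]
      exact le_antisymm (key b2 b3 b4 b5 a2 a3 a4 a5 s2 s1) (key a2 a3 a4 a5 b2 b3 b4 b5 s1 s2)
  · obtain ⟨h1, h2⟩ := floor_ceil_eq_of_not_mem_walls h.1 hy
    obtain ⟨h3, h4⟩ := floor_ceil_eq_of_not_mem_walls h'.1 hy
    exact ⟨h3.trans h1.symm, h4.trans h2.symm⟩

/-- Every subset of the walls through a vertex `y` is the set of walls through a cell of
which `y` is the bottom. -/
theorem exists_isBottom_of_subset_walls {ξ : E →ₗ[ℝ] ℝ} (hξ : IsGeneric g ξ) {y : E}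
    {e : ι → E} (he : IsDualFrame g (walls g β y) e) {T : Finset ι} (hT : T ⊆ walls g β y) :
    ∃ x, walls g β x = T ∧ IsBottom g β ξ x y := by
  classical
  set u : E := ∑ j ∈ walls g β y \ T, ξ (e j) • e j with hu
  have huT : ∀ i ∈ T, g i u = 0 := by
    intro i hi
    rw [hu, map_sum]
    refine Finset.sum_eq_zero fun j hj => ?_
    rw [Finset.mem_sdiff] at hj
    rw [map_smul, he.1 i (hT hi) j hj.1 (by rintro rfl; exact hj.2 hi), smul_zero]
  have huS : ∀ i ∈ walls g β y \ T, g i u = ξ (e i) := by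
    intro i hi
    rw [hu, map_sum, Finset.sum_eq_single_of_mem i hi, map_smul,
      he.2.1 i (Finset.mem_sdiff.1 hi).1, smul_eq_mul, mul_one]
    intro j hj hij
    rw [map_smul, he.1 i (Finset.mem_sdiff.1 hi).1 j (Finset.mem_sdiff.1 hj).1 hij.symm,
      smul_zero]
  have hev : ∀ᶠ s in 𝓝[>] (0 : ℝ), ∀ i,
      (i ∈ walls g β y → level g β i y - 1 < level g β i y + s * g i u ∧
        level g β i y + s * g i u < level g β i y + 1) ∧
      (i ∉ walls g β y → (⌊level g β i y⌋ : ℝ) < level g β i y + s * g i u ∧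
        level g β i y + s * g i u < ⌈level g β i y⌉) := by
    refine eventually_all.2 fun i => ?_
    by_cases hi : i ∈ walls g β y
    · simp only [hi, not_true_eq_false, false_imp_iff, and_true, true_imp_iff]
      exact eventually_mem_Ioo_add_mul (by linarith) (by linarith)
    · simp only [hi, not_false_eq_true, false_imp_iff, true_and, true_imp_iff]
      obtain ⟨h1, h2, -⟩ := floor_lt_self_lt_ceil (mt mem_walls.2 hi)
      exact eventually_mem_Ioo_add_mul h1 h2
  obtain ⟨s, hs, hs0⟩ := (hev.and self_mem_nhdsWithin).exists
  have hs0 : 0 < s := hs0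
  have hlev : ∀ i, level g β i (y + s • u) = level g β i y + s * g i u := fun i => by
    rw [level_add, map_smul, smul_eq_mul]
  -- on the walls through `y` not in `T`, the sign of `ξ (e i)` decides the slab of `y + s • u`
  have hS : ∀ i ∈ walls g β y \ T, ∃ z : ℤ, level g β i y = z ∧
      (0 < ξ (e i) ∧ ⌊level g β i (y + s • u)⌋ = z ∧ ⌈level g β i (y + s • u)⌉ = z + 1 ∨
        ξ (e i) < 0 ∧ ⌊level g β i (y + s • u)⌋ = z - 1 ∧ ⌈level g β i (y + s • u)⌉ = z) ∧
      ¬ ∃ w : ℤ, level g β i (y + s • u) = w := by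
    intro i hi
    have hiy := (Finset.mem_sdiff.1 hi).1
    obtain ⟨z, hz⟩ := mem_walls.1 hiy
    have h1 := (hs i).1 hiy
    rw [hlev, hz, huS i hi]
    rw [hz, huS i hi] at h1
    refine ⟨z, rfl, ?_⟩
    rcases lt_or_gt_of_ne (he.apply_ne_zero hξ hiy) with h2 | h2
    · have h3 := mul_neg_of_pos_of_neg hs0 h2
      have := floor_ceil_of_between (z := z - 1) (t := z + s * ξ (e i))
        (by push_cast; linarith) (by push_cast; linarith)
      exact ⟨Or.inr ⟨h2, this.1, by rw [this.2.1]; ring⟩, this.2.2⟩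
    · have h3 := mul_pos hs0 h2
      have := floor_ceil_of_between (z := z) (t := z + s * ξ (e i))
        (by linarith) (by linarith)
      exact ⟨Or.inl ⟨h2, this.1, this.2.1⟩, this.2.2⟩
  have hTlev : ∀ i ∈ T, level g β i (y + s • u) = level g β i y := fun i hi => by
    rw [hlev, huT i hi, mul_zero, add_zero]
  have hN : ∀ i ∉ walls g β y, ⌊level g β i (y + s • u)⌋ = ⌊level g β i y⌋ ∧
      ⌈level g β i (y + s • u)⌉ = ⌈level g β i y⌉ ∧
      ¬ ∃ w : ℤ, level g β i (y + s • u) = w := by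
    intro i hi
    obtain ⟨-, -, h3⟩ := floor_lt_self_lt_ceil (mt mem_walls.2 hi)
    have h := (hs i).2 hi
    rw [h3, ← hlev] at h
    rw [h3]
    exact floor_ceil_of_between h.1 (by exact_mod_cast h.2)
  have hwalls : walls g β (y + s • u) = T := by
    ext i
    by_cases hiT : i ∈ T
    · simp only [hiT, iff_true]
      rw [mem_walls, hTlev i hiT]
      exact mem_walls.1 (hT hiT)
    · simp only [hiT, iff_false]
      by_cases hi : i ∈ walls g β y
      · obtain ⟨z, -, -, h⟩ := hS i (Finset.mem_sdiff.2 ⟨hi, hiT⟩)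
        exact mt mem_walls.1 h
      · exact mt mem_walls.1 (hN i hi).2.2
  have hmem : y ∈ closedCell g β (y + s • u) := by
    intro i
    by_cases hiT : i ∈ T
    · rw [hTlev i hiT]
      exact mem_closedCell_self y i
    · by_cases hi : i ∈ walls g β y
      · obtain ⟨z, hz, h | h, -⟩ := hS i (Finset.mem_sdiff.2 ⟨hi, hiT⟩) <;>
        · rw [h.2.1, h.2.2, hz]
          push_cast
          constructor <;> linarith
      · obtain ⟨h1, h2, -⟩ := hN i hi
        rw [h1, h2]
        exact mem_closedCell_self y i
  refine ⟨y + s • u, hwalls, hmem, fun z hz => ?_⟩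
  suffices 0 ≤ ξ (z - y) by rw [map_sub] at this; linarith
  rw [he.apply_eq]
  refine Finset.sum_nonneg fun j hj => ?_
  have h1 := level_eq_add_sub g β j z y
  by_cases hjT : j ∈ T
  · rw [level_eq_of_mem_closedCell hz (hwalls.symm ▸ hjT), hTlev j hjT] at h1
    have : g j (z - y) = 0 := by linarith
    rw [this, zero_mul]
  · have h2 := hz j
    obtain ⟨p, hp, h | h, -⟩ := hS j (Finset.mem_sdiff.2 ⟨hj, hjT⟩)
    · rw [h.2.1] at h2
      exact mul_nonneg (by linarith) h.1.le
    · rw [h.2.2] at h2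
      exact mul_nonneg_of_nonpos_of_nonpos (by linarith) h.1.le

end Periodic

section Compactness

variable {E ι : Type*} [NormedAddCommGroup E] [NormedSpace ℝ E] [FiniteDimensional ℝ E]
  {g : ι → E →ₗ[ℝ] ℝ} {β : ι → ℝ}

theorem continuous_level (i : ι) : Continuous (level g β i) :=
  (LinearMap.continuous_of_finiteDimensional (g i)).sub continuous_const

theorem isCompact_closedCell {J : Finset ι} {e : ι → E} (he : IsDualFrame g J e) (x : E) :
    IsCompact (closedCell g β x) := by
  let lo : ι → ℝ := fun i => ⌊level g β i x⌋ + β i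
  let hi : ι → ℝ := fun i => ⌈level g β i x⌉ + β i
  have hc : Continuous fun c : ι → ℝ => ∑ j ∈ J, c j • e j := by fun_prop
  refine ((isCompact_Icc (a := lo) (b := hi)).image hc).of_isClosed_subset ?_ ?_
  · simp only [closedCell, ofPred_forall, ofPred_and]
    exact isClosed_iInter fun i => (isClosed_le continuous_const (continuous_level i)).inter
      (isClosed_le (continuous_level i) continuous_const)
  · intro y hy
    refine ⟨fun i => g i y, ⟨fun i => ?_, fun i => ?_⟩, (he.2.2 y).symm⟩
    · have := (hy i).1
      simp only [lo, level] at this ⊢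
      linarith
    · have := (hy i).2
      simp only [hi, level] at this ⊢
      linarith

theorem exists_isBottom {ξ : E →ₗ[ℝ] ℝ} {J : Finset ι} {e : ι → E} (he : IsDualFrame g J e)
    (x : E) : ∃ y, IsBottom g β ξ x y :=
  (isCompact_closedCell he x).exists_isMinOn ⟨x, mem_closedCell_self x⟩
    (LinearMap.continuous_of_finiteDimensional ξ).continuousOn

theorem IsBottom.finrank_le_card_walls [Fintype ι] {ξ : E →ₗ[ℝ] ℝ} (hξ : IsGeneric g ξ) {x y : E}
    (h : IsBottom g β ξ x y) : Module.finrank ℝ E ≤ (walls g β y).card := by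
  by_contra! hlt
  let G : E →ₗ[ℝ] (walls g β y → ℝ) := LinearMap.pi fun i => g i
  have hker : LinearMap.ker G ≠ ⊥ := LinearMap.ker_ne_bot_of_finrank_lt (by simpa using hlt)
  obtain ⟨w, hw, hw0⟩ := (Submodule.ne_bot_iff _).1 hker
  obtain ⟨v, hv, hv0⟩ := hξ (walls g β y) ⟨w, hw0, fun i hi => congrFun hw ⟨i, hi⟩⟩
  have key : ∀ c : ℝ, 0 ≤ ξ (c • v) := fun c => h.apply_nonneg fun i hi => by
    rw [map_smul, hv i hi, smul_zero, add_zero]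
    exact h.1 i
  have h1 := key 1
  have h2 := key (-1)
  simp only [one_smul, neg_smul, map_neg] at h1 h2
  exact hv0 (by linarith)

end Compactness

section Translation

variable {E ι : Type*} [AddCommGroup E] [Module ℝ E] {g : ι → E →ₗ[ℝ] ℝ} {β : ι → ℝ} {z : E}

theorem floor_ceil_level_add (hz : ∀ i, ∃ k : ℤ, g i z = k) (i : ι) :
    ∃ k : ℤ, ∀ x, level g β i (x + z) = level g β i x + k ∧
      ⌊level g β i (x + z)⌋ = ⌊level g β i x⌋ + k ∧
      ⌈level g β i (x + z)⌉ = ⌈level g β i x⌉ + k := by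
  obtain ⟨k, hk⟩ := hz i
  refine ⟨k, fun x => ?_⟩
  rw [level_add, hk, Int.floor_add_intCast, Int.ceil_add_intCast]
  exact ⟨rfl, rfl, rfl⟩

theorem add_mem_cell_add (hz : ∀ i, ∃ k : ℤ, g i z = k) {x y : E} :
    y + z ∈ cell g β (x + z) ↔ y ∈ cell g β x := by
  refine forall_congr' fun i => ?_
  obtain ⟨k, hk⟩ := floor_ceil_level_add (β := β) hz i
  rw [(hk x).2.1, (hk x).2.2, (hk y).2.1, (hk y).2.2, add_left_inj, add_left_inj]

theorem add_mem_closedCell_add (hz : ∀ i, ∃ k : ℤ, g i z = k) {x y : E} :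
    y + z ∈ closedCell g β (x + z) ↔ y ∈ closedCell g β x := by
  refine forall_congr' fun i => ?_
  obtain ⟨k, hk⟩ := floor_ceil_level_add (β := β) hz i
  rw [(hk x).2.1, (hk x).2.2, (hk y).1]
  push_cast
  rw [add_le_add_iff_right, add_le_add_iff_right]

theorem IsBottom.add (hz : ∀ i, ∃ k : ℤ, g i z = k) {ξ : E →ₗ[ℝ] ℝ} {x y : E}
    (h : IsBottom g β ξ x y) : IsBottom g β ξ (x + z) (y + z) := by
  refine ⟨(add_mem_closedCell_add hz).2 h.1, fun w hw => ?_⟩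
  have hw' : w - z ∈ closedCell g β x := by
    rwa [← add_mem_closedCell_add hz, sub_add_cancel]
  have := h.2 _ hw'
  rw [map_sub] at this
  rw [map_add]
  linarith

theorem IsBottom.of_mem_cell {ξ : E →ₗ[ℝ] ℝ} {x x' y : E} (h : IsBottom g β ξ x y)
    (hx : x' ∈ cell g β x) : IsBottom g β ξ x' y := by
  rwa [IsBottom, closedCell_eq_of_mem hx]

theorem convex_cell (x : E) : Convex ℝ (cell g β x) := by
  have h : cell g β x = ⋂ i, g i ⁻¹' {t | ⌊t - β i⌋ = ⌊level g β i x⌋ ∧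
      ⌈t - β i⌉ = ⌈level g β i x⌉} := by
    ext y; simp [cell, level]
  rw [h]
  refine convex_iInter fun i => Convex.linear_preimage (Set.OrdConnected.convex ⟨?_⟩) (g i)
  rintro s ⟨hs1, hs2⟩ t ⟨ht1, ht2⟩ r ⟨hsr, hrt⟩
  have h1 := Int.floor_le_floor (sub_le_sub_right hsr (β i))
  have h2 := Int.floor_le_floor (sub_le_sub_right hrt (β i))
  have h3 := Int.ceil_le_ceil (sub_le_sub_right hsr (β i))
  have h4 := Int.ceil_le_ceil (sub_le_sub_right hrt (β i))
  constructor <;> omega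

end Translation

/-! ### Quotients of the periodic arrangement -/

section Quotient

variable {E ι X : Type*} [NormedAddCommGroup E] [NormedSpace ℝ E]

/-- `π : E → X` is a quotient by a group `L` of translations preserving the periodic arrangement,
and `K i` is the image of its `i`-th family of hyperplanes. -/
structure IsPeriodicQuotient [TopologicalSpace X] (g : ι → E →ₗ[ℝ] ℝ) (β : ι → ℝ)
    (L : AddSubgroup E) (π : E → X) (K : ι → Set X) : Prop where
  continuous : Continuous π
  isOpenMap : IsOpenMap π
  surjective : Function.Surjective π
  eq_iff : ∀ x y, π x = π y ↔ y - x ∈ L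
  integral : ∀ z ∈ L, ∀ i, ∃ k : ℤ, g i z = k
  mem_iff : ∀ x i, π x ∈ K i ↔ ∃ k : ℤ, level g β i x = k

/-- The indices of the hypersurfaces `K i` through `p`. -/
noncomputable def through [Fintype ι] (K : ι → Set X) (p : X) : Finset ι :=
  open Classical in {i | p ∈ K i}

/-- Pairs of a point on exactly `d` hypersurfaces and `d - k` of the hypersurfaces through it. -/
def cornerFlags [Fintype ι] (K : ι → Set X) (d k : ℕ) : Set (X × Finset ι) :=
  {p | (through K p.1).card = d ∧ p.2 ⊆ through K p.1 ∧ p.2.card + k = d}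

theorem mem_through [Fintype ι] {K : ι → Set X} {p : X} {i : ι} : i ∈ through K p ↔ p ∈ K i := by
  simp [through]

theorem nonempty_cornerFlags_equiv [Fintype ι] (K : ι → Set X) {d k : ℕ} (hk : k ≤ d) :
    Nonempty (cornerFlags K d k ≃ cornerFlags K d (d - k)) := by
  classical
  have key : ∀ k ≤ d, ∀ p ∈ cornerFlags K d k,
      (p.1, through K p.1 \ p.2) ∈ cornerFlags K d (d - k) := by
    rintro k hk ⟨v, T⟩ ⟨h1, h2, h3⟩
    refine ⟨h1, Finset.sdiff_subset, ?_⟩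
    have := Finset.card_sdiff_add_card_eq_card h2
    simp only at h1 h3 this ⊢
    omega
  refine ⟨⟨fun p => ⟨_, key k hk p p.2⟩, fun p => ⟨(p.1.1, through K p.1.1 \ p.1.2), ?_⟩,
    ?_, ?_⟩⟩
  · have := key (d - k) (Nat.sub_le _ _) p p.2
    rwa [Nat.sub_sub_self hk] at this
  · rintro ⟨⟨v, T⟩, h1, h2, h3⟩
    ext <;> simp [Finset.inter_eq_right.2 h2]
  · rintro ⟨⟨v, T⟩, h1, h2, h3⟩
    ext <;> simp [Finset.inter_eq_right.2 h2]

variable {g : ι → E →ₗ[ℝ] ℝ} {β : ι → ℝ} {L : AddSubgroup E} {π : E → X} {K : ι → Set X}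

/-- The open star of the cell of `x`. -/
def openStar [Fintype ι] (g : ι → E →ₗ[ℝ] ℝ) (β : ι → ℝ) (x : E) : Set E :=
  {y | ∀ i, (i ∉ walls g β x → level g β i y ∈ Ioo (⌊level g β i x⌋ : ℝ) ⌈level g β i x⌉) ∧
    (i ∈ walls g β x → level g β i y ∈ Ioo (level g β i x - 1) (level g β i x + 1))}

theorem mem_openStar_of_mem_cell [Fintype ι] {x y : E} (h : y ∈ cell g β x) :
    y ∈ openStar g β x := by
  refine fun i => ⟨fun hi => ?_, fun hi => ?_⟩
  · rw [← (h i).1, ← (h i).2]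
    have := floor_lt_self_lt_ceil (mt mem_walls.2 (walls_eq_of_mem_cell h ▸ hi))
    exact ⟨this.1, this.2.1⟩
  · have : y ∈ closedCell g β x := closedCell_eq_of_mem h ▸ mem_closedCell_self y
    rw [level_eq_of_mem_closedCell this hi]
    constructor <;> linarith

theorem mem_cell_of_mem_openStar [Fintype ι] {x y : E} (h : y ∈ openStar g β x)
    (hc : (walls g β x).card ≤ (walls g β y).card) : y ∈ cell g β x := by
  have hsub : walls g β y ⊆ walls g β x := by
    intro i hi
    by_contra hx
    obtain ⟨h1, h2⟩ := (h i).1 hx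
    rw [(floor_lt_self_lt_ceil (mt mem_walls.2 hx)).2.2] at h2
    exact (floor_ceil_of_between h1 (by exact_mod_cast h2)).2.2 (mem_walls.1 hi)
  have heq := Finset.eq_of_subset_of_card_le hsub hc
  refine mem_cell_of_walls (fun i hi => ?_) fun i hi => (h i).1 hi
  obtain ⟨p, hp⟩ := mem_walls.1 hi
  obtain ⟨q, hq⟩ := mem_walls.1 (heq ▸ hi)
  obtain ⟨h1, h2⟩ := (h i).2 hi
  rw [hp, hq] at h1 h2 ⊢
  have h1 : p - 1 < q := by exact_mod_cast h1
  have h2 : q < p + 1 := by exact_mod_cast h2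
  norm_cast
  omega

namespace IsPeriodicQuotient

variable [TopologicalSpace X]

/-- Images of cells meeting each other coincide up to a translation. -/
theorem exists_translate (h : IsPeriodicQuotient g β L π K) {x x' : E}
    (hx : π x' ∈ π '' cell g β x) : ∃ z ∈ L, x' + z ∈ cell g β x := by
  obtain ⟨y, hy, hxy⟩ := hx
  refine ⟨y - x', (h.eq_iff _ _).1 hxy.symm, ?_⟩
  simpa using hy

theorem image_cell_add (h : IsPeriodicQuotient g β L π K) {z : E} (hz : z ∈ L) (x : E) :
    π '' cell g β (x + z) = π '' cell g β x := by
  have key : ∀ x, ∀ z ∈ L, π '' cell g β x ⊆ π '' cell g β (x + z) := by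
    rintro x z hz _ ⟨y, hy, rfl⟩
    exact ⟨y + z, (add_mem_cell_add (h.integral z hz)).2 hy,
      (h.eq_iff _ _).2 (by simpa using L.neg_mem hz)⟩
  refine subset_antisymm ?_ (key x z hz)
  simpa using key (x + z) (-z) (L.neg_mem hz)

variable [Fintype ι]

theorem through_eq (h : IsPeriodicQuotient g β L π K) (x : E) :
    through K (π x) = walls g β x := by
  ext i; rw [mem_through, mem_walls, h.mem_iff]

theorem walls_eq (h : IsPeriodicQuotient g β L π K) {x y : E} (hxy : π x = π y) :
    walls g β x = walls g β y := by
  rw [← h.through_eq, ← h.through_eq, hxy]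

variable [FiniteDimensional ℝ E]

theorem isOpen_openStar (x : E) : IsOpen (openStar g β x) := by
  have h : openStar g β x = ⋂ i,
      {y | (i ∉ walls g β x →
          level g β i y ∈ Ioo (⌊level g β i x⌋ : ℝ) ⌈level g β i x⌉) ∧
        (i ∈ walls g β x → level g β i y ∈ Ioo (level g β i x - 1) (level g β i x + 1))} := by
    ext y; simp only [openStar, mem_iInter, mem_ofPred_eq]
  rw [h]
  refine isOpen_iInter_of_finite fun i => ?_
  by_cases hi : i ∈ walls g β x
  · simp only [hi, not_true_eq_false, false_imp_iff, true_imp_iff, true_and]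
    exact isOpen_Ioo.preimage (continuous_level i)
  · simp only [hi, not_false_eq_true, false_imp_iff, true_imp_iff, and_true]
    exact isOpen_Ioo.preimage (continuous_level i)

theorem connectedComponentIn_eq (h : IsPeriodicQuotient g β L π K) {A : Set X} {x : E}
    (hA : ∀ y, walls g β y = walls g β x → π y ∈ A)
    (hcard : ∀ y, π y ∈ A → (walls g β y).card = (walls g β x).card) :
    connectedComponentIn A (π x) = π '' cell g β x := by
  apply subset_antisymm
  · let U := π '' openStar g β x
    let V := ⋃ y ∈ {y | π y ∈ A ∧ π y ∉ π '' cell g β x}, π '' openStar g β y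
    have hU : IsOpen U := h.isOpenMap _ (isOpen_openStar x)
    have hV : IsOpen V := isOpen_biUnion fun y _ => h.isOpenMap _ (isOpen_openStar y)
    have hstar : ∀ y, π y ∈ A → ∀ q ∈ A, q ∈ π '' openStar g β y → q ∈ π '' cell g β y := by
      rintro y hy _ hq ⟨w, hw, rfl⟩
      exact ⟨w, mem_cell_of_mem_openStar hw (by rw [hcard _ hy, hcard _ hq]), rfl⟩
    have hsub := connectedComponentIn_subset A (π x)
    have hx : π x ∈ A := hA x rfl
    have hxU : π x ∈ U := ⟨x, mem_openStar_of_mem_cell (mem_cell_self x), rfl⟩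
    have hdisj : A ∩ (U ∩ V) = ∅ := by
      rw [Set.eq_empty_iff_forall_notMem]
      rintro q ⟨hqA, hqU, hqV⟩
      obtain ⟨y, ⟨hyA, hyx⟩, hqy⟩ := mem_iUnion₂.1 hqV
      obtain ⟨w, hw, rfl⟩ := hstar x hx q hqA hqU
      obtain ⟨z, hz, hwz⟩ := h.exists_translate (hstar y hyA _ hqA hqy)
      apply hyx
      rw [← cell_eq_of_mem hw, ← h.image_cell_add hz, cell_eq_of_mem hwz]
      exact mem_image_of_mem _ (mem_cell_self y)
    have hcover : A ⊆ U ∪ V := by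
      intro q hq
      obtain ⟨y, rfl⟩ := h.surjective q
      by_cases hy : π y ∈ π '' cell g β x
      · exact Or.inl (image_mono (fun _ => mem_openStar_of_mem_cell) hy)
      · exact Or.inr (mem_iUnion₂.2 ⟨y, ⟨hq, hy⟩, y,
          mem_openStar_of_mem_cell (mem_cell_self y), rfl⟩)
    rcases isPreconnected_iff_subset_of_disjoint.1
      (isPreconnected_connectedComponentIn (F := A) (x := π x)) U V hU hV (hsub.trans hcover)
      (subset_empty_iff.1 (hdisj ▸ inter_subset_inter_left _ hsub)) with hc | hc
    · exact fun q hq => hstar x hx q (hsub hq) (hc hq)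
    · have : π x ∈ A ∩ (U ∩ V) := ⟨hx, hxU, hc (mem_connectedComponentIn hx)⟩
      rw [hdisj] at this
      exact this.elim
  · refine ((convex_cell x).isPreconnected.image _
      h.continuous.continuousOn).subset_connectedComponentIn
      (mem_image_of_mem _ (mem_cell_self x)) ?_
    rintro _ ⟨y, hy, rfl⟩
    exact hA y (walls_eq_of_mem_cell hy)

theorem sigIn_eq (h : IsPeriodicQuotient g β L π K) {d : ℕ}
    (hle : ∀ x, (walls g β x).card ≤ d) (k : ℕ) (hk : k ≤ d) :
    SigIn univ d K k = {C | ∃ x, (walls g β x).card + k = d ∧ C = π '' cell g β x} := by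
  induction k using Nat.strong_induction_on with
  | _ k ih =>
  have hcomps : ∀ A : Set X, (∀ x, π x ∈ A → (∀ y, walls g β y = walls g β x → π y ∈ A) ∧
      ∀ y, π y ∈ A → (walls g β y).card = (walls g β x).card) →
      comps A = {C | ∃ x, π x ∈ A ∧ C = π '' cell g β x} := by
    intro A hA
    ext C
    constructor
    · rintro ⟨p, hp, rfl⟩
      obtain ⟨x, rfl⟩ := h.surjective p
      exact ⟨x, hp, h.connectedComponentIn_eq (hA x hp).1 (hA x hp).2⟩
    · rintro ⟨x, hx, rfl⟩
      exact ⟨π x, hx, (h.connectedComponentIn_eq (hA x hx).1 (hA x hx).2).symm⟩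
  have hmem : ∀ (S : Finset ι) x, π x ∈ ⋂ i ∈ S, K i ↔ S ⊆ walls g β x := by
    intro S x
    simp only [mem_iInter, ← h.through_eq, Finset.subset_iff, mem_through]
  rw [SigIn, Nat.strongRecOn_eq]
  split_ifs with h0 h1
  · have hA : ∀ x, π x ∈ ⋃ S ∈ {S : Finset ι | S.card = d}, ⋂ i ∈ S, K i ↔
        (walls g β x).card = d := by
      intro x
      rw [mem_iUnion₂]
      simp only [hmem]
      constructor
      · rintro ⟨S, hS, hSx⟩
        exact le_antisymm (hle x) (hS ▸ Finset.card_le_card hSx)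
      · exact fun hx => ⟨_, hx, subset_rfl⟩
    rw [hcomps _ fun x hx => ?_]
    · simp only [hA, h0, add_zero]
    · rw [hA] at hx
      simp only [hA]
      exact ⟨fun y hy => hy ▸ hx, fun y hy => hy.trans hx.symm⟩
  · have hA : ∀ x, π x ∈ univ \ ⋃ i, K i ↔ (walls g β x).card = 0 := by
      intro x
      simp [Finset.eq_empty_iff_forall_notMem, ← h.through_eq, mem_through]
    rw [hcomps _ fun x hx => ?_]
    · simp only [hA, h1, Nat.add_eq_right]
    · rw [hA] at hx
      simp only [hA]
      exact ⟨fun y hy => hy ▸ hx, fun y hy => hy.trans hx.symm⟩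
  · have hlow : ∀ x, π x ∈ ⋃ j : Fin k, ⋃ σ ∈ SigIn univ d K j, σ ↔
        d < (walls g β x).card + k := by
      intro x
      simp only [mem_iUnion]
      constructor
      · rintro ⟨j, σ, hσ, hx⟩
        rw [ih j j.isLt (by omega)] at hσ
        obtain ⟨y, hy, rfl⟩ := hσ
        obtain ⟨w, hw, hwx⟩ := hx
        rw [← h.walls_eq hwx, walls_eq_of_mem_cell hw]
        omega
      · intro hx
        have := hle x
        refine ⟨⟨d - (walls g β x).card, by omega⟩, π '' cell g β x, ?_,
          mem_image_of_mem _ (mem_cell_self x)⟩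
        rw [ih _ (by simp only; omega) (by simp only; omega)]
        exact ⟨x, by simp only; omega, rfl⟩
    have hA : ∀ S : Finset ι, S.card = d - k → ∀ x,
        π x ∈ (⋂ i ∈ S, K i) \ ⋃ j : Fin k, ⋃ σ ∈ SigIn univ d K j, σ ↔ walls g β x = S := by
      intro S hS x
      rw [Set.mem_sdiff, hlow, hmem]
      constructor
      · rintro ⟨h1, h2⟩
        exact (Finset.eq_of_subset_of_card_le h1 (by omega)).symm
      · rintro rfl
        exact ⟨subset_rfl, by omega⟩
    ext C
    rw [mem_iUnion₂]
    constructor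
    · rintro ⟨S, hS, hC⟩
      change C ∈ comps (_ \ ⋃ j : Fin k, ⋃ σ ∈ SigIn univ d K j, σ) at hC
      rw [hcomps _ fun x hx => ?_] at hC
      · obtain ⟨x, hx, rfl⟩ := hC
        rw [hA S hS] at hx
        have hS : S.card = d - k := hS
        exact ⟨x, by rw [hx]; omega, rfl⟩
      · rw [hA S hS] at hx
        simp only [hA S hS]
        exact ⟨fun y hy => hy ▸ hx, fun y hy => by rw [hy, hx]⟩
    · rintro ⟨x, hx, rfl⟩
      have hS : (walls g β x).card = d - k := by omega
      refine ⟨_, hS, ?_⟩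
      change _ ∈ comps (_ \ ⋃ j : Fin k, ⋃ σ ∈ SigIn univ d K j, σ)
      rw [hcomps _ fun y hy => ?_]
      · exact ⟨x, (hA _ hS x).2 rfl, rfl⟩
      · rw [hA _ hS] at hy
        simp only [hA _ hS]
        exact ⟨fun w hw => hw ▸ hy, fun w hw => by rw [hw, hy]⟩

end IsPeriodicQuotient

theorem nonempty_equiv_of_existsUnique {α γ : Type*} (R : α → γ → Prop)
    (h1 : ∀ a, ∃! c, R a c) (h2 : ∀ c, ∃! a, R a c) : Nonempty (α ≃ γ) := by
  choose F hF hF' using h1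
  refine ⟨Equiv.ofBijective F ⟨fun a b hab => ?_, fun c => ?_⟩⟩
  · exact (h2 (F a)).unique (hF a) (hab ▸ hF b)
  · obtain ⟨a, ha, -⟩ := h2 c
    exact ⟨a, (hF' a c ha).symm⟩

namespace IsPeriodicQuotient

variable [TopologicalSpace X] [Fintype ι] [FiniteDimensional ℝ E]

/-- Sending a cell to its bottom vertex, together with the walls containing the cell, is a
bijection from the `k`-cells onto the corner flags. -/
theorem nonempty_cells_equiv_cornerFlags (h : IsPeriodicQuotient g β L π K)
    (hle : ∀ x, (walls g β x).card ≤ Module.finrank ℝ E)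
    (hframe : ∀ x, (walls g β x).card = Module.finrank ℝ E →
      ∃ e, IsDualFrame g (walls g β x) e)
    (hspan : ∃ J e, IsDualFrame g J e) (k : ℕ) :
    Nonempty ({C | ∃ x, (walls g β x).card + k = Module.finrank ℝ E ∧ C = π '' cell g β x} ≃
      cornerFlags K (Module.finrank ℝ E) k) := by
  obtain ⟨ξ, hξ⟩ := exists_isGeneric (g := g)
  obtain ⟨J, e₀, he₀⟩ := hspan
  have hvert : ∀ {x y}, IsBottom g β ξ x y → (walls g β y).card = Module.finrank ℝ E :=
    fun hxy => le_antisymm (hle _) (hxy.finrank_le_card_walls hξ)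
  refine nonempty_equiv_of_existsUnique (fun C p => ∃ x y, IsBottom g β ξ x y ∧
    C.1 = π '' cell g β x ∧ p.1 = (π y, walls g β x)) ?_ ?_
  · rintro ⟨C, x, hx, rfl⟩
    obtain ⟨y, hy⟩ := exists_isBottom (β := β) (ξ := ξ) he₀ x
    refine ⟨⟨(π y, walls g β x), ?_⟩, ⟨x, y, hy, rfl, rfl⟩, ?_⟩
    · refine ⟨?_, ?_, hx⟩
      · rw [h.through_eq]; exact hvert hy
      · rw [h.through_eq]; exact walls_subset_of_mem_closedCell hy.1
    · rintro ⟨p, hp⟩ ⟨x', y', hy', hC, rfl : p = _⟩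
      obtain ⟨z, hz, hxz⟩ := h.exists_translate
        (hC ▸ mem_image_of_mem π (mem_cell_self x) : π x ∈ π '' cell g β x')
      have hb := (hy'.of_mem_cell hxz)
      have hb' := hy.add (h.integral z hz)
      obtain ⟨e, he⟩ := hframe y' (hvert hy')
      have hyy : y + z = y' := hb.eq_of_le hξ hb'.1 he (hb'.2 _ hb.1)
      have h1 : π y' = π y := (h.eq_iff _ _).2 (by rw [← hyy]; simpa using L.neg_mem hz)
      have h2 : walls g β x' = walls g β x := by
        rw [← walls_eq_of_mem_cell hxz]
        exact h.walls_eq ((h.eq_iff _ _).2 (by simpa using L.neg_mem hz))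
      simp only [h1, h2]
  · rintro ⟨⟨v, T⟩, hv, hT, hc⟩
    obtain ⟨y, rfl⟩ := h.surjective v
    simp only [h.through_eq] at hv hT hc
    obtain ⟨e, he⟩ := hframe y hv
    obtain ⟨x, rfl, hxy⟩ := exists_isBottom_of_subset_walls hξ he hT
    refine ⟨⟨_, x, hc, rfl⟩, ⟨x, y, hxy, rfl, rfl⟩, ?_⟩
    rintro ⟨C, hC⟩ ⟨x', y', hy', rfl : C = _, hp⟩
    simp only [Prod.mk.injEq] at hp
    have hz : y - y' ∈ L := (h.eq_iff _ _).1 hp.1.symm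
    have hb := hy'.add (h.integral _ hz)
    rw [add_sub_cancel] at hb
    have hw : walls g β (x' + (y - y')) = walls g β x := by
      rw [hp.2]
      exact h.walls_eq ((h.eq_iff _ _).2 (by simpa using L.neg_mem hz))
    have := mem_cell_of_isBottom hξ hxy hb he hw
    simp only [Subtype.mk.injEq]
    rw [← cell_eq_of_mem this, h.image_cell_add hz]

end IsPeriodicQuotient

end Quotient

/-! ### The torus -/

/-- The linear form `x ↦ a₁x₁ + ⋯ + aₙxₙ`. -/
noncomputable def linForm {n : ℕ} (a : Fin n → ℤ) : (Fin n → ℝ) →ₗ[ℝ] ℝ :=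
  ∑ j, (a j : ℝ) • LinearMap.proj j

theorem linForm_apply {n : ℕ} (a : Fin n → ℤ) (x : Fin n → ℝ) :
    linForm a x = ∑ j, (a j : ℝ) * x j := by
  simp [linForm]

/-- The lattice `ℤⁿ` in `ℝⁿ`. -/
def intLattice (n : ℕ) : AddSubgroup (Fin n → ℝ) :=
  AddSubgroup.pi univ fun _ => AddSubgroup.zmultiples (1 : ℝ)

theorem theta_coe {n : ℕ} (a : Fin n → ℤ) (x : Fin n → ℝ) :
    theta a (fun j => (x j : AddCircle (1 : ℝ))) = (linForm a x : ℝ) := by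
  rw [theta, linForm_apply, QuotientAddGroup.mk_sum]
  refine Finset.sum_congr rfl fun j _ => ?_
  rw [← zsmul_eq_mul]; rfl

theorem isPeriodicQuotient_torus {n : ℕ} {ι : Type*} [Fintype ι] (a : ι → Fin n → ℤ)
    (β : ι → ℝ) :
    IsPeriodicQuotient (fun i => linForm (a i)) β (intLattice n)
      (fun x j => (x j : AddCircle (1 : ℝ))) (fun i => Hyp (a i) (β i : AddCircle (1 : ℝ))) where
  continuous := continuous_pi fun j =>
    (AddCircle.continuous_mk' (1 : ℝ)).comp (continuous_apply j)
  isOpenMap := IsOpenMap.piMap (fun _ => QuotientAddGroup.isOpenMap_coe)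
    (Eventually.of_forall fun _ => QuotientAddGroup.mk_surjective)
  surjective p := by
    choose x hx using fun j => QuotientAddGroup.mk_surjective (p j)
    exact ⟨x, funext hx⟩
  eq_iff x y := by
    rw [eq_comm, funext_iff]
    simp only [intLattice, AddSubgroup.mem_pi, mem_univ, true_imp_iff, Pi.sub_apply]
    exact forall_congr' fun j => QuotientAddGroup.eq_iff_sub_mem
  integral z hz i := by
    simp only [intLattice, AddSubgroup.mem_pi, mem_univ, true_imp_iff,
      AddSubgroup.mem_zmultiples_iff, zsmul_eq_mul, mul_one] at hz
    choose k hk using hz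
    refine ⟨∑ j, a i j * k j, ?_⟩
    rw [linForm_apply]
    push_cast
    exact Finset.sum_congr rfl fun j _ => by rw [hk]
  mem_iff x i := by
    change theta (a i) (fun j => (x j : AddCircle (1 : ℝ))) = _ ↔ _
    rw [theta_coe, QuotientAddGroup.eq_iff_sub_mem]
    simp only [AddSubgroup.mem_zmultiples_iff, zsmul_eq_mul, mul_one, level, eq_comm]

theorem exists_isDualFrame {n : ℕ} {ι : Type*} (a : ι → Fin n → ℤ) {S : Finset ι}
    (hS : S.card = n) (hli : LinearIndependent ℚ (fun i : S => fun j => (a i.1 j : ℚ))) :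
    ∃ e, IsDualFrame (fun i => linForm (a i)) S e := by
  classical
  let σ : Fin n ≃ S := (Finset.equivFinOfCardEq hS).symm
  let M : Matrix (Fin n) (Fin n) ℚ := fun i j => a (σ i) j
  have hM : IsUnit M := by
    rw [← Matrix.linearIndependent_rows_iff_isUnit]
    exact hli.comp σ σ.injective
  let N : Matrix (Fin n) (Fin n) ℝ := fun i j => a (σ i) j
  have hN : IsUnit N := by
    have : N = (algebraMap ℚ ℝ).mapMatrix M := by
      ext i j; exact (map_intCast (algebraMap ℚ ℝ) _).symm
    rw [this]
    exact hM.map _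
  have hdet := (Matrix.isUnit_iff_isUnit_det N).1 hN
  have hNv : ∀ (i : Fin n) (w : Fin n → ℝ), linForm (a (σ i)) w = (N.mulVec w) i := by
    intro i w; rw [linForm_apply]; rfl
  have hdual : ∀ i j : Fin n, linForm (a (σ i)) (fun l => N⁻¹ l j) = if i = j then 1 else 0 := by
    intro i j
    rw [linForm_apply]
    change (N * N⁻¹) i j = _
    rw [Matrix.mul_nonsing_inv N hdet, Matrix.one_apply]
  refine ⟨fun i => if hi : i ∈ S then fun l => N⁻¹ l (σ.symm ⟨i, hi⟩) else 0, ?_, ?_, ?_⟩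
  · intro i hi j hj hij
    have := hdual (σ.symm ⟨i, hi⟩) (σ.symm ⟨j, hj⟩)
    rw [if_neg (by simpa using hij)] at this
    simpa [hj] using this
  · intro i hi
    have := hdual (σ.symm ⟨i, hi⟩) (σ.symm ⟨i, hi⟩)
    simpa [hi] using this
  · intro w
    rw [← Finset.sum_coe_sort, ← σ.sum_comp]
    have : N⁻¹.mulVec (N.mulVec w) = w := by
      rw [Matrix.mulVec_mulVec, Matrix.nonsing_inv_mul N hdet, Matrix.one_mulVec]
    conv_lhs => rw [← this]
    ext l
    simp [Matrix.mulVec_eq_sum, hNv, mul_comm]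

/-- Symmetry of the `f`-vector: for a spanning toric hyperplane arrangement in general
position with at least `n` hyperplanes, there is a bijection `Σ_k(A) ≃ Σ_{n-k}(A)`;
in particular `f_k(A) = f_{n-k}(A)` for all `0 ≤ k ≤ n`. -/
theorem fvector_symmetric {n m : ℕ}
    (a : Fin m → Fin n → ℤ) (b : Fin m → AddCircle (1 : ℝ))
    (ha : ∀ i, a i ≠ 0) (hm : n ≤ m) (hspan : Spanning a) (hgp : GenPos a b) :
    ∀ k ≤ n,
      Nonempty (↥(SigIn Set.univ n (fun i => Hyp (a i) (b i)) k) ≃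
        ↥(SigIn Set.univ n (fun i => Hyp (a i) (b i)) (n - k))) ∧
      Nat.card ↥(SigIn Set.univ n (fun i => Hyp (a i) (b i)) k) =
        Nat.card ↥(SigIn Set.univ n (fun i => Hyp (a i) (b i)) (n - k)) := by
  intro k hk
  choose β hβ using fun i => QuotientAddGroup.mk_surjective (b i)
  obtain rfl : (fun i => (β i : AddCircle (1 : ℝ))) = b := funext hβ
  have h := isPeriodicQuotient_torus a β
  have hli : ∀ x, LinearIndependent ℚ
      (fun i : walls (fun i => linForm (a i)) β x => fun j => (a i.1 j : ℚ)) := by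
    intro x
    refine hgp _ ⟨fun j => (x j : AddCircle (1 : ℝ)), mem_iInter₂.2 fun i hi => ?_⟩
    rw [← h.through_eq] at hi
    exact mem_through (K := fun i => Hyp (a i) (β i : AddCircle (1 : ℝ))).1 hi
  have hle : ∀ x, (walls (fun i => linForm (a i)) β x).card ≤ n := fun x => by
    simpa using (hli x).fintype_card_le_finrank
  obtain ⟨s, hs, hsli⟩ := hspan
  have hflag : ∀ k ≤ n, Nonempty (SigIn univ n (fun i => Hyp (a i) (β i : AddCircle (1 : ℝ))) k ≃
      cornerFlags (fun i => Hyp (a i) (β i : AddCircle (1 : ℝ))) n k) := by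
    intro k hk
    rw [h.sigIn_eq hle k hk]
    have := h.nonempty_cells_equiv_cornerFlags (by simpa using hle)
      (fun x hx => exists_isDualFrame a (by simpa using hx) (hli x))
      ⟨s, exists_isDualFrame a hs hsli⟩ k
    simpa only [Module.finrank_fin_fun] using this
  obtain ⟨e₁⟩ := hflag k hk
  obtain ⟨e₂⟩ := nonempty_cornerFlags_equiv (fun i => Hyp (a i) (β i : AddCircle (1 : ℝ))) hk
  obtain ⟨e₃⟩ := hflag (n - k) (Nat.sub_le _ _)
  have e := (e₁.trans e₂).trans e₃.symm
  exact ⟨⟨e⟩, Nat.card_congr e⟩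
end

section
/- Let (A, Tⁿ) be a spanning toric hyperplane arrangement in general position with |A| ≥ n, with intersection poset L(A), Möbius function μ, and characteristic polynomial χ_A(t) = Σ_{x ∈ L(A)} μ(Tⁿ, x) · t^{dim(x)}, where dim(x) = n − |{i : x ⊆ Hᵢ}|. Then the number of regions of A satisfies f_n(A) = (−1)ⁿ · χ_A(0). -/
open Set

/-- The underlying set of the intersection poset `L(A)` of an arrangement: the whole
torus `Tⁿ` together with all connected components of the nonempty intersections
`⋂_{i ∈ S} H i` over nonempty subsets `S`. The poset order is reverse inclusion, with
minimum element `Tⁿ`. -/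
def LSet {n m : ℕ} (H : Fin m → Set (Torus n)) : Set (Set (Torus n)) :=
  {Set.univ} ∪
    {C | ∃ S : Finset (Fin m), S.Nonempty ∧
      ∃ x ∈ ⋂ i ∈ S, H i, C = connectedComponentIn (⋂ i ∈ S, H i) x}

section Cells

variable {n m : ℕ}

open scoped Matrix

/-- The open cell with index `k` of the periodic hyperplane arrangement
`{x | A i ⬝ᵥ x ∈ β i + ℤ}` in `ℝⁿ`. -/
def OpenCell (A : Fin m → Fin n → ℝ) (β : Fin m → ℝ) (k : Fin m → ℤ) : Set (Fin n → ℝ) :=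
  {x | ∀ i, β i + k i < A i ⬝ᵥ x ∧ A i ⬝ᵥ x < β i + k i + 1}

/-- The closed cell with index `k`. -/
def ClosedCell (A : Fin m → Fin n → ℝ) (β : Fin m → ℝ) (k : Fin m → ℤ) : Set (Fin n → ℝ) :=
  {x | ∀ i, β i + k i ≤ A i ⬝ᵥ x ∧ A i ⬝ᵥ x ≤ β i + k i + 1}

/-- The point `y` minimises the functional `ℓ` on the closed cell with index `k`. -/
def MinAt (A : Fin m → Fin n → ℝ) (β : Fin m → ℝ) (ℓ : Fin n → ℝ) (k : Fin m → ℤ)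
    (y : Fin n → ℝ) : Prop :=
  y ∈ ClosedCell A β k ∧ ∀ z ∈ ClosedCell A β k, ℓ ⬝ᵥ y ≤ ℓ ⬝ᵥ z

theorem exists_dotProduct_eq {S : Finset (Fin m)} {A : Fin m → Fin n → ℝ}
    (h : LinearIndependent ℝ (fun i : S => A i)) (t : Fin m → ℝ) :
    ∃ w : Fin n → ℝ, ∀ i ∈ S, A i ⬝ᵥ w = t i := by
  obtain ⟨f, hf⟩ := LinearMap.exists_extend
    ((Module.Basis.span h).constr ℝ (fun i : S => t i))
  refine ⟨(dotProductEquiv ℝ (Fin n)).symm f, fun i hi => ?_⟩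
  have h1 : (dotProductEquiv ℝ (Fin n)) ((dotProductEquiv ℝ (Fin n)).symm f) (A i) = f (A i) := by
    rw [LinearEquiv.apply_symm_apply]
  rw [dotProductEquiv_apply_apply, dotProduct_comm] at h1
  rw [h1]
  have h2 := LinearMap.congr_fun hf ((Module.Basis.span h) ⟨i, hi⟩)
  rw [Module.Basis.constr_basis, LinearMap.comp_apply, Submodule.subtype_apply,
    Module.Basis.span_apply] at h2
  exact h2

theorem eq_zero_of_dotProduct_eq_zero {S : Set (Fin m)} {A : Fin m → Fin n → ℝ}
    (h : Submodule.span ℝ (A '' S) = ⊤) {w : Fin n → ℝ} (hw : ∀ i ∈ S, A i ⬝ᵥ w = 0) : w = 0 := by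
  have h1 : ∀ v : Fin n → ℝ, v ⬝ᵥ w = 0 := by
    intro v
    have hv : v ∈ Submodule.span ℝ (A '' S) := by rw [h]; trivial
    induction hv using Submodule.span_induction with
    | mem x hx => obtain ⟨i, hi, rfl⟩ := hx; exact hw i hi
    | zero => simp
    | add x y _ _ hx hy => simp [add_dotProduct, hx, hy]
    | smul c x _ hx => simp [hx]
  exact dotProduct_self_eq_zero.1 (h1 w)

theorem exists_dotProduct_neg_of_notMem_span {S : Set (Fin m)} {A : Fin m → Fin n → ℝ}
    {ℓ : Fin n → ℝ} (h : ℓ ∉ Submodule.span ℝ (A '' S)) :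
    ∃ w : Fin n → ℝ, (∀ i ∈ S, A i ⬝ᵥ w = 0) ∧ ℓ ⬝ᵥ w < 0 := by
  obtain ⟨f, hf, hle⟩ := Submodule.exists_le_ker_of_notMem h
  have key : ∀ v, v ⬝ᵥ ((dotProductEquiv ℝ (Fin n)).symm f) = f v := by
    intro v
    have h1 : (dotProductEquiv ℝ (Fin n)) ((dotProductEquiv ℝ (Fin n)).symm f) v = f v := by
      rw [LinearEquiv.apply_symm_apply]
    rwa [dotProductEquiv_apply_apply, dotProduct_comm] at h1
  refine ⟨-(f ℓ) • (dotProductEquiv ℝ (Fin n)).symm f, fun i hi => ?_, ?_⟩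
  · have : f (A i) = 0 := hle (Submodule.subset_span ⟨i, hi, rfl⟩)
    rw [dotProduct_smul, key, this, smul_zero]
  · rw [dotProduct_smul, key, smul_eq_mul]
    have := mul_self_pos.2 hf
    linarith

variable {A : Fin m → Fin n → ℝ} {β : Fin m → ℝ} {ℓ : Fin n → ℝ} {k k' : Fin m → ℤ}
  {y y' : Fin n → ℝ}

theorem openCell_subset_closedCell : OpenCell A β k ⊆ ClosedCell A β k :=
  fun _ hx i => ⟨(hx i).1.le, (hx i).2.le⟩

theorem isOpen_openCell : IsOpen (OpenCell A β k) := by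
  have : OpenCell A β k =
      ⋂ i, {x | β i + k i < A i ⬝ᵥ x} ∩ {x | A i ⬝ᵥ x < β i + k i + 1} := by
    ext x; simp [OpenCell]
  rw [this]
  refine isOpen_iInter_of_finite fun i => IsOpen.inter ?_ ?_
  · exact isOpen_lt (by fun_prop) (by unfold dotProduct; fun_prop)
  · exact isOpen_lt (by unfold dotProduct; fun_prop) (by fun_prop)

theorem convex_openCell : Convex ℝ (OpenCell A β k) := by
  have : OpenCell A β k =
      ⋂ i, {x | β i + k i < A i ⬝ᵥ x} ∩ {x | A i ⬝ᵥ x < β i + k i + 1} := by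
    ext x; simp [OpenCell]
  rw [this]
  have hl : ∀ i, IsLinearMap ℝ (fun x : Fin n → ℝ => A i ⬝ᵥ x) :=
    fun i => ⟨fun x y => dotProduct_add _ _ _, fun c x => dotProduct_smul _ _ _⟩
  exact convex_iInter fun i => (convex_halfSpace_gt (hl i) _).inter (convex_halfSpace_lt (hl i) _)

theorem isCompact_closedCell_s12 (hA : Submodule.span ℝ (Set.range A) = ⊤) :
    IsCompact (ClosedCell A β k) := by
  let Φ : (Fin n → ℝ) →ₗ[ℝ] (Fin m → ℝ) := Matrix.mulVecLin (Matrix.of A)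
  have hΦ : ∀ x i, Φ x i = A i ⬝ᵥ x := fun x i => rfl
  have hker : LinearMap.ker Φ = ⊥ := by
    rw [LinearMap.ker_eq_bot']
    intro x hx
    refine eq_zero_of_dotProduct_eq_zero (S := Set.univ) (by rwa [Set.image_univ]) fun i _ => ?_
    rw [← hΦ, hx]; rfl
  have hc := (LinearMap.isClosedEmbedding_of_injective hker).isCompact_preimage
    (isCompact_Icc (a := fun i => β i + (k i : ℝ)) (b := fun i => β i + (k i : ℝ) + 1))
  convert hc using 1
  ext x
  simp only [ClosedCell, mem_ofPred_eq, mem_preimage, mem_Icc, Pi.le_def, hΦ, forall_and]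

theorem exists_minAt (hA : Submodule.span ℝ (Set.range A) = ⊤)
    (hne : (ClosedCell A β k).Nonempty) : ∃ y, MinAt A β ℓ k y := by
  obtain ⟨y, hy, hmin⟩ := (isCompact_closedCell_s12 (β := β) (k := k) hA).exists_isMinOn hne
    (f := fun x => ℓ ⬝ᵥ x) (by unfold dotProduct; fun_prop)
  exact ⟨y, hy, fun z hz => hmin hz⟩

theorem exists_add_smul_mem_closedCell {w : Fin n → ℝ} (hy : y ∈ ClosedCell A β k)
    (h1 : ∀ i, A i ⬝ᵥ y = β i + k i → 0 ≤ A i ⬝ᵥ w)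
    (h2 : ∀ i, A i ⬝ᵥ y = β i + k i + 1 → A i ⬝ᵥ w ≤ 0) :
    ∃ ε : ℝ, 0 < ε ∧ y + ε • w ∈ ClosedCell A β k := by
  have hc : ∀ i, Filter.Tendsto (fun ε : ℝ => A i ⬝ᵥ (y + ε • w)) (nhdsWithin 0 (Set.Ioi 0))
      (nhds (A i ⬝ᵥ y)) := by
    intro i
    have : Continuous (fun ε : ℝ => A i ⬝ᵥ (y + ε • w)) := by unfold dotProduct; fun_prop
    simpa using (this.tendsto 0).mono_left nhdsWithin_le_nhds
  have hev : ∀ᶠ ε : ℝ in nhdsWithin 0 (Set.Ioi 0), y + ε • w ∈ ClosedCell A β k := by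
    refine Filter.eventually_all.2 fun i => Filter.Eventually.and ?_ ?_
    · rcases (hy i).1.eq_or_lt with h | h
      · filter_upwards [self_mem_nhdsWithin] with ε hε
        rw [dotProduct_add, dotProduct_smul, smul_eq_mul]
        have := mul_nonneg (le_of_lt hε) (h1 i h.symm)
        linarith
      · exact ((hc i).eventually (lt_mem_nhds h)).mono fun _ h => h.le
    · rcases (hy i).2.eq_or_lt with h | h
      · filter_upwards [self_mem_nhdsWithin] with ε hε
        rw [dotProduct_add, dotProduct_smul, smul_eq_mul]
        have := mul_nonneg (le_of_lt hε) (neg_nonneg.2 (h2 i h))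
        linarith
      · exact ((hc i).eventually (gt_mem_nhds h)).mono fun _ h => h.le
  obtain ⟨ε, hε, h0⟩ := (hev.and self_mem_nhdsWithin).exists
  exact ⟨ε, h0, hε⟩

theorem nonempty_openCell_of_direction {w : Fin n → ℝ} (hy : y ∈ ClosedCell A β k)
    (h1 : ∀ i, A i ⬝ᵥ y = β i + k i → 0 < A i ⬝ᵥ w)
    (h2 : ∀ i, A i ⬝ᵥ y = β i + k i + 1 → A i ⬝ᵥ w < 0) :
    (OpenCell A β k).Nonempty := by
  have hc : ∀ i, Filter.Tendsto (fun ε : ℝ => A i ⬝ᵥ (y + ε • w)) (nhdsWithin 0 (Set.Ioi 0))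
      (nhds (A i ⬝ᵥ y)) := by
    intro i
    have : Continuous (fun ε : ℝ => A i ⬝ᵥ (y + ε • w)) := by unfold dotProduct; fun_prop
    simpa using (this.tendsto 0).mono_left nhdsWithin_le_nhds
  have hev : ∀ᶠ ε : ℝ in nhdsWithin 0 (Set.Ioi 0), y + ε • w ∈ OpenCell A β k := by
    refine Filter.eventually_all.2 fun i => Filter.Eventually.and ?_ ?_
    · rcases (hy i).1.eq_or_lt with h | h
      · filter_upwards [self_mem_nhdsWithin] with ε hε
        rw [dotProduct_add, dotProduct_smul, smul_eq_mul]
        have := mul_pos hε (h1 i h.symm)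
        linarith
      · exact (hc i).eventually (lt_mem_nhds h)
    · rcases (hy i).2.eq_or_lt with h | h
      · filter_upwards [self_mem_nhdsWithin] with ε hε
        rw [dotProduct_add, dotProduct_smul, smul_eq_mul]
        have := mul_pos hε (neg_pos.2 (h2 i h))
        linarith
      · exact (hc i).eventually (gt_mem_nhds h)
  obtain ⟨ε, hε⟩ := hev.exists
  exact ⟨_, hε⟩

/-- The hyperplanes of the periodic arrangement passing through `y`. -/
def Active (A : Fin m → Fin n → ℝ) (β : Fin m → ℝ) (y : Fin n → ℝ) : Set (Fin m) :=
  {i | ∃ k : ℤ, A i ⬝ᵥ y = β i + k}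

theorem MinAt.span_active_eq_top
    (hgen : ∀ S : Set (Fin m), ℓ ∈ Submodule.span ℝ (A '' S) → Submodule.span ℝ (A '' S) = ⊤)
    (h : MinAt A β ℓ k y) : Submodule.span ℝ (A '' Active A β y) = ⊤ := by
  refine hgen _ ?_
  by_contra hn
  obtain ⟨w, hw, hneg⟩ := exists_dotProduct_neg_of_notMem_span hn
  obtain ⟨ε, hε, hmem⟩ := exists_add_smul_mem_closedCell (w := w) h.1
    (fun i hi => (hw i ⟨k i, hi⟩).ge)
    (fun i hi => (hw i ⟨k i + 1, by push_cast; linarith⟩).le)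
  have := h.2 _ hmem
  rw [dotProduct_add, dotProduct_smul, smul_eq_mul] at this
  nlinarith

theorem exists_coeffs_active
    (hgen : ∀ S : Set (Fin m), ℓ ∈ Submodule.span ℝ (A '' S) → Submodule.span ℝ (A '' S) = ⊤)
    {S : Finset (Fin m)} (hS : LinearIndependent ℝ (fun i : S => A i))
    (hspan : Submodule.span ℝ (A '' S) = ⊤) :
    ∃ c : Fin m → ℝ, (∀ v, ℓ ⬝ᵥ v = ∑ i ∈ S, c i * (A i ⬝ᵥ v)) ∧ ∀ i ∈ S, c i ≠ 0 := by
  have hl : ℓ ∈ Submodule.span ℝ (A '' S) := by rw [hspan]; trivial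
  obtain ⟨c, hc⟩ : ∃ c : Fin m → ℝ, ∑ i ∈ S, c i • A i = ℓ := by
    classical
    obtain ⟨c, hc⟩ := (Submodule.mem_span_image_finset_iff_exists_fun ℝ).1 hl
    refine ⟨fun i => if h : i ∈ S then c ⟨i, h⟩ else 0, ?_⟩
    rw [← Finset.sum_coe_sort, ← hc]
    exact Finset.sum_congr rfl fun i _ => by simp
  refine ⟨c, fun v => ?_, fun i hi h0 => ?_⟩
  · rw [← hc, sum_dotProduct]
    simp
  · have hl' : ℓ ∈ Submodule.span ℝ (A '' (S.erase i : Finset (Fin m))) := by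
      rw [← hc, ← Finset.add_sum_erase _ _ hi, h0, zero_smul, zero_add]
      exact Submodule.sum_mem _ fun j hj =>
        Submodule.smul_mem _ _ (Submodule.subset_span ⟨j, hj, rfl⟩)
    obtain ⟨w, hw⟩ := exists_dotProduct_eq hS (Pi.single i 1)
    have hw0 := eq_zero_of_dotProduct_eq_zero (hgen _ hl') (w := w) fun j hj => by
      rw [Finset.mem_coe, Finset.mem_erase] at hj
      rw [hw j hj.2, Pi.single_eq_of_ne hj.1]
    have := hw i hi
    simp [hw0] at this

theorem MinAt.eq_bound_of_coeff_sign {S : Finset (Fin m)} (hact : (S : Set (Fin m)) = Active A β y)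
    (hS : LinearIndependent ℝ (fun i : S => A i)) {c : Fin m → ℝ}
    (hc : ∀ v, ℓ ⬝ᵥ v = ∑ i ∈ S, c i * (A i ⬝ᵥ v)) (h : MinAt A β ℓ k y) {i : Fin m} (hi : i ∈ S) :
    (0 < c i → A i ⬝ᵥ y = β i + k i) ∧ (c i < 0 → A i ⬝ᵥ y = β i + k i + 1) := by
  have hval : A i ⬝ᵥ y = β i + k i ∨ A i ⬝ᵥ y = β i + k i + 1 := by
    have hi' : i ∈ Active A β y := by rw [← hact]; exact hi
    obtain ⟨p, hp⟩ := hi'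
    have h1 := (h.1 i).1
    have h2 := (h.1 i).2
    rw [hp] at h1 h2 ⊢
    have h3 : k i ≤ p := by exact_mod_cast (by linarith : (k i : ℝ) ≤ p)
    have h4 : p ≤ k i + 1 := by exact_mod_cast (by linarith : (p : ℝ) ≤ k i + 1)
    have h5 : p = k i ∨ p = k i + 1 := by omega
    rcases h5 with rfl | h5
    · left; rfl
    · right; rw [h5]; push_cast; ring
  have key : ∀ s : ℝ, (A i ⬝ᵥ y = β i + k i → 0 ≤ s) → (A i ⬝ᵥ y = β i + k i + 1 → s ≤ 0) →
      0 ≤ c i * s := by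
    intro s hs1 hs2
    obtain ⟨w, hw⟩ := exists_dotProduct_eq hS (Pi.single i s)
    have hmemS : ∀ j, (∃ p : ℤ, A j ⬝ᵥ y = β j + p) → j ∈ S := by
      intro j hj
      have : j ∈ Active A β y := hj
      rwa [← hact] at this
    obtain ⟨ε, hε, hmem⟩ := exists_add_smul_mem_closedCell (w := w) h.1
      (fun j hj => by
        rw [hw j (hmemS j ⟨_, hj⟩)]
        by_cases hji : j = i
        · subst hji; simpa using hs1 hj
        · rw [Pi.single_eq_of_ne hji])
      (fun j hj => by
        rw [hw j (hmemS j ⟨k j + 1, by push_cast; linarith⟩)]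
        by_cases hji : j = i
        · subst hji; simpa using hs2 hj
        · rw [Pi.single_eq_of_ne hji])
    have h1 := h.2 _ hmem
    rw [dotProduct_add, dotProduct_smul, smul_eq_mul, hc w, Finset.sum_eq_single i
      (fun j hj hji => by rw [hw j hj, Pi.single_eq_of_ne hji, mul_zero])
      (fun hn => absurd hi hn), hw i hi, Pi.single_eq_same] at h1
    nlinarith
  constructor
  · intro hpos
    by_contra hn
    have := key (-1) (fun h' => absurd h' hn) (fun _ => by norm_num)
    linarith
  · intro hneg
    by_contra hn
    have := key 1 (fun _ => by norm_num) (fun h' => absurd h' hn)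
    linarith

theorem eq_floor_of_notMem_active (hy : y ∈ ClosedCell A β k) {i : Fin m}
    (hi : i ∉ Active A β y) : k i = ⌊A i ⬝ᵥ y - β i⌋ := by
  symm
  rw [Int.floor_eq_iff]
  refine ⟨by linarith [(hy i).1], ?_⟩
  have : A i ⬝ᵥ y ≠ β i + k i + 1 := fun h => hi ⟨k i + 1, by push_cast; linarith⟩
  have := lt_of_le_of_ne (hy i).2 this
  linarith

section GeneralPosition

variable
    (hgen : ∀ S : Set (Fin m), ℓ ∈ Submodule.span ℝ (A '' S) → Submodule.span ℝ (A '' S) = ⊤)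
    (hind : ∀ (y : Fin n → ℝ) (S : Finset (Fin m)), (S : Set (Fin m)) = Active A β y →
      LinearIndependent ℝ (fun i : S => A i))

include hgen hind

theorem MinAt.index_unique (h : MinAt A β ℓ k y) (h' : MinAt A β ℓ k' y) : k = k' := by
  classical
  obtain ⟨S, hS⟩ := (Active A β y).toFinite.exists_finset_coe
  have hspan := h.span_active_eq_top hgen
  rw [← hS] at hspan
  obtain ⟨c, hc, hc0⟩ := exists_coeffs_active hgen (hind y S hS) hspan
  funext i
  by_cases hi : i ∈ S
  · have e := h.eq_bound_of_coeff_sign hS (hind y S hS) hc hi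
    have e' := h'.eq_bound_of_coeff_sign hS (hind y S hS) hc hi
    rcases lt_or_gt_of_ne (hc0 i hi) with h0 | h0
    · have := (e.2 h0).symm.trans (e'.2 h0)
      exact_mod_cast (by linarith : (k i : ℝ) = k' i)
    · have := (e.1 h0).symm.trans (e'.1 h0)
      exact_mod_cast (by linarith : (k i : ℝ) = k' i)
  · have hi' : i ∉ Active A β y := by rw [← hS]; exact hi
    rw [eq_floor_of_notMem_active h.1 hi', eq_floor_of_notMem_active h'.1 hi']

theorem MinAt.point_unique (h : MinAt A β ℓ k y) (h' : MinAt A β ℓ k y') : y' = y := by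
  classical
  obtain ⟨S, hS⟩ := (Active A β y).toFinite.exists_finset_coe
  have hspan := h.span_active_eq_top hgen
  rw [← hS] at hspan
  obtain ⟨c, hc, hc0⟩ := exists_coeffs_active hgen (hind y S hS) hspan
  have hnn : ∀ i ∈ S, 0 ≤ c i * (A i ⬝ᵥ (y' - y)) := by
    intro i hi
    have e := h.eq_bound_of_coeff_sign hS (hind y S hS) hc hi
    rw [dotProduct_sub]
    rcases lt_or_gt_of_ne (hc0 i hi) with h0 | h0
    · rw [e.2 h0]
      exact mul_nonneg_of_nonpos_of_nonpos h0.le (by linarith [(h'.1 i).2])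
    · rw [e.1 h0]
      exact mul_nonneg h0.le (by linarith [(h'.1 i).1])
  have hsum : ∑ i ∈ S, c i * (A i ⬝ᵥ (y' - y)) = 0 := by
    rw [← hc, dotProduct_sub]
    linarith [h.2 _ h'.1, h'.2 _ h.1]
  rw [Finset.sum_eq_zero_iff_of_nonneg hnn] at hsum
  rw [← sub_eq_zero]
  exact eq_zero_of_dotProduct_eq_zero hspan fun i hi =>
    (mul_eq_zero.1 (hsum i hi)).resolve_left (hc0 i hi)

theorem exists_minAt_of_span_active (hspan : Submodule.span ℝ (A '' Active A β y) = ⊤) :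
    ∃ k, MinAt A β ℓ k y ∧ (OpenCell A β k).Nonempty := by
  classical
  obtain ⟨S, hS⟩ := (Active A β y).toFinite.exists_finset_coe
  rw [← hS] at hspan
  obtain ⟨c, hc, hc0⟩ := exists_coeffs_active hgen (hind y S hS) hspan
  let k : Fin m → ℤ := fun i =>
    if i ∈ S ∧ c i < 0 then ⌊A i ⬝ᵥ y - β i⌋ - 1 else ⌊A i ⬝ᵥ y - β i⌋
  have hfl : ∀ i ∈ S, A i ⬝ᵥ y = β i + ⌊A i ⬝ᵥ y - β i⌋ := by
    intro i hi
    have hi' : i ∈ Active A β y := by rw [← hS]; exact hi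
    obtain ⟨p, hp⟩ := hi'
    have : A i ⬝ᵥ y - β i = p := by linarith
    rw [this, Int.floor_intCast, hp]
  have hneg : ∀ i ∈ S, c i < 0 → A i ⬝ᵥ y = β i + k i + 1 := by
    intro i hi h0
    simp only [k, if_pos (And.intro hi h0)]
    have := hfl i hi
    push_cast
    linarith
  have hpos : ∀ i ∈ S, 0 < c i → A i ⬝ᵥ y = β i + k i := by
    intro i hi h0
    simp only [k, if_neg (fun h : i ∈ S ∧ c i < 0 => absurd h.2 h0.not_gt)]
    exact hfl i hi
  have hout : ∀ i ∉ S, β i + k i < A i ⬝ᵥ y ∧ A i ⬝ᵥ y < β i + k i + 1 := by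
    intro i hi
    have hk : k i = ⌊A i ⬝ᵥ y - β i⌋ := if_neg fun h => hi h.1
    have h1 := Int.floor_le (A i ⬝ᵥ y - β i)
    have h2 := Int.lt_floor_add_one (A i ⬝ᵥ y - β i)
    rw [← hk] at h1 h2
    refine ⟨lt_of_le_of_ne (by linarith) fun h => hi ?_, by linarith⟩
    have hi' : i ∈ Active A β y := ⟨k i, h.symm⟩
    rwa [← hS] at hi'
  have hmem : y ∈ ClosedCell A β k := by
    intro i
    by_cases hi : i ∈ S
    · rcases lt_or_gt_of_ne (hc0 i hi) with h0 | h0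
      · have := hneg i hi h0; constructor <;> linarith
      · have := hpos i hi h0; constructor <;> linarith
    · exact ⟨(hout i hi).1.le, (hout i hi).2.le⟩
  refine ⟨k, ⟨hmem, fun z hz => ?_⟩, ?_⟩
  · rw [hc, hc]
    refine Finset.sum_le_sum fun i hi => ?_
    rcases lt_or_gt_of_ne (hc0 i hi) with h0 | h0
    · exact mul_le_mul_of_nonpos_left (by rw [hneg i hi h0]; exact (hz i).2) h0.le
    · exact mul_le_mul_of_nonneg_left (by rw [hpos i hi h0]; exact (hz i).1) h0.le
  · obtain ⟨w, hw⟩ := exists_dotProduct_eq (hind y S hS) c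
    refine nonempty_openCell_of_direction (w := w) hmem (fun i hi => ?_) (fun i hi => ?_)
    · have hiS : i ∈ S := by
        by_contra hn
        exact (hout i hn).1.ne' hi
      rw [hw i hiS]
      refine lt_of_le_of_ne (not_lt.1 fun h0 => ?_) (hc0 i hiS).symm
      have := hneg i hiS h0
      linarith
    · have hiS : i ∈ S := by
        by_contra hn
        exact (hout i hn).2.ne hi
      rw [hw i hiS]
      refine lt_of_le_of_ne (not_lt.1 fun h0 => ?_) (hc0 i hiS)
      have := hpos i hiS h0
      linarith

end GeneralPosition

theorem exists_generic_functional (A : Fin m → Fin n → ℝ) : ∃ ℓ : Fin n → ℝ,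
    ∀ S : Set (Fin m), ℓ ∈ Submodule.span ℝ (A '' S) → Submodule.span ℝ (A '' S) = ⊤ := by
  by_contra! h
  obtain ⟨⟨S, hS⟩, hS'⟩ := Subspace.exists_eq_top_of_iUnion_eq_univ (k := ℝ)
    (p := fun S : {S : Set (Fin m) // Submodule.span ℝ (A '' S) ≠ ⊤} =>
      Submodule.span ℝ (A '' (S : Set (Fin m)))) (by
      refine Set.eq_univ_of_forall fun ℓ => ?_
      obtain ⟨S, h1, h2⟩ := h ℓ
      exact Set.mem_iUnion.2 ⟨⟨S, h2⟩, h1⟩)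
  exact hS hS'

end Cells

theorem comps_eq_image_of_partition {X ι : Type*} [TopologicalSpace X] {U : Set X} {V : Set ι}
    {W : ι → Set X} (hU : U = ⋃ p ∈ V, W p) (hopen : ∀ p ∈ V, IsOpen (W p))
    (hpre : ∀ p ∈ V, IsPreconnected (W p)) (hne : ∀ p ∈ V, (W p).Nonempty)
    (hdisj : ∀ p ∈ V, ∀ q ∈ V, (W p ∩ W q).Nonempty → p = q) :
    comps U = W '' V := by
  have key : ∀ p ∈ V, ∀ x ∈ W p, connectedComponentIn U x = W p := by
    intro p hp x hx
    have hWU : W p ⊆ U := hU ▸ Set.subset_biUnion_of_mem (u := W) hp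
    refine Set.Subset.antisymm ?_ ((hpre p hp).subset_connectedComponentIn hx hWU)
    refine IsPreconnected.subset_left_of_subset_union (hopen p hp)
      (isOpen_biUnion (s := V \ {p}) (f := W) fun q hq => hopen q hq.1) ?_ ?_
      ⟨x, mem_connectedComponentIn (hWU hx), hx⟩ isPreconnected_connectedComponentIn
    · refine Set.disjoint_left.2 fun z hz hz' => ?_
      obtain ⟨q, hq, hzq⟩ := Set.mem_iUnion₂.1 hz'
      exact hq.2 (hdisj p hp q hq.1 ⟨z, hz, hzq⟩).symm
    · intro z hz
      have hz' := connectedComponentIn_subset U x hz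
      rw [hU] at hz'
      obtain ⟨q, hq, hzq⟩ := Set.mem_iUnion₂.1 hz'
      by_cases hqp : q = p
      · left; rwa [← hqp]
      · right; exact Set.mem_iUnion₂.2 ⟨q, ⟨hq, hqp⟩, hzq⟩
  ext C
  constructor
  · rintro ⟨x, hx, rfl⟩
    rw [hU] at hx
    obtain ⟨p, hp, hxp⟩ := Set.mem_iUnion₂.1 hx
    exact ⟨p, hp, (key p hp x hxp).symm⟩
  · rintro ⟨p, hp, rfl⟩
    obtain ⟨x, hx⟩ := hne p hp
    exact ⟨x, hU ▸ Set.mem_biUnion hp hx, (key p hp x hx).symm⟩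

section TorusLifts

variable {n m : ℕ}

open scoped Matrix

/-- The covering map `ℝⁿ → Tⁿ`. -/
def torusProj (x : Fin n → ℝ) : Torus n := fun j => (x j : AddCircle (1 : ℝ))

/-- An integer vector regarded as a real vector. -/
def realVec (a : Fin n → ℤ) : Fin n → ℝ := fun j => (a j : ℝ)

theorem theta_torusProj (a : Fin n → ℤ) (x : Fin n → ℝ) :
    theta a (torusProj x) = ((realVec a ⬝ᵥ x : ℝ) : AddCircle (1 : ℝ)) := by
  have h : ((realVec a ⬝ᵥ x : ℝ) : AddCircle (1 : ℝ)) =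
      QuotientAddGroup.mk' (AddSubgroup.zmultiples (1 : ℝ)) (∑ j, a j • x j) := by
    simp only [dotProduct, realVec, zsmul_eq_mul]
    rfl
  rw [h, map_sum]
  exact Finset.sum_congr rfl fun j _ => by rw [map_zsmul]; rfl

theorem theta_add (a : Fin n → ℤ) (x y : Torus n) : theta a (x + y) = theta a x + theta a y := by
  simp [theta, smul_add, Finset.sum_add_distrib]

theorem continuous_torusProj : Continuous (torusProj : (Fin n → ℝ) → Torus n) :=
  continuous_pi fun j => (AddCircle.continuous_mk' 1).comp (continuous_apply j)

theorem surjective_torusProj : Function.Surjective (torusProj : (Fin n → ℝ) → Torus n) := by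
  intro p
  choose x hx using fun j => QuotientAddGroup.mk_surjective (p j)
  exact ⟨x, funext hx⟩

theorem isOpenMap_torusProj : IsOpenMap (torusProj : (Fin n → ℝ) → Torus n) :=
  IsOpenMap.piMap (fun _ => QuotientAddGroup.isOpenMap_coe)
    (Filter.Eventually.of_forall fun _ => QuotientAddGroup.mk_surjective)

theorem coe_eq_coe_iff_exists_add_int {x y : ℝ} :
    (x : AddCircle (1 : ℝ)) = y ↔ ∃ k : ℤ, x = y + k := by
  rw [← sub_eq_zero, ← AddCircle.coe_sub, AddCircle.coe_eq_zero_iff]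
  refine exists_congr fun k => ?_
  rw [zsmul_eq_mul, mul_one]
  constructor <;> intro h <;> linarith

theorem torusProj_add_realVec (x : Fin n → ℝ) (z : Fin n → ℤ) :
    torusProj (x + realVec z) = torusProj x :=
  funext fun j => coe_eq_coe_iff_exists_add_int.2 ⟨z j, rfl⟩

theorem exists_eq_add_of_torusProj_eq {x y : Fin n → ℝ} (h : torusProj x = torusProj y) :
    ∃ z : Fin n → ℤ, x = y + realVec z := by
  choose z hz using fun j => coe_eq_coe_iff_exists_add_int.1 (congrFun h j)
  exact ⟨z, funext hz⟩

theorem realVec_dotProduct_realVec (a z : Fin n → ℤ) :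
    realVec a ⬝ᵥ realVec z = ((a ⬝ᵥ z : ℤ) : ℝ) := by
  simp [realVec, dotProduct]

variable {a : Fin m → Fin n → ℤ} {β : Fin m → ℝ} {ℓ : Fin n → ℝ} {k k' : Fin m → ℤ}
  {x y : Fin n → ℝ}

theorem add_realVec_mem_openCell (z : Fin n → ℤ) (hx : x ∈ OpenCell (realVec ∘ a) β k) :
    x + realVec z ∈ OpenCell (realVec ∘ a) β (fun i => k i + a i ⬝ᵥ z) := by
  intro i
  have := hx i
  simp only [Function.comp_apply, dotProduct_add, realVec_dotProduct_realVec] at this ⊢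
  push_cast
  constructor <;> linarith

theorem add_realVec_mem_closedCell (z : Fin n → ℤ) (hx : x ∈ ClosedCell (realVec ∘ a) β k) :
    x + realVec z ∈ ClosedCell (realVec ∘ a) β (fun i => k i + a i ⬝ᵥ z) := by
  intro i
  have := hx i
  simp only [Function.comp_apply, dotProduct_add, realVec_dotProduct_realVec] at this ⊢
  push_cast
  constructor <;> linarith

theorem MinAt.add_realVec (z : Fin n → ℤ) (h : MinAt (realVec ∘ a) β ℓ k y) :
    MinAt (realVec ∘ a) β ℓ (fun i => k i + a i ⬝ᵥ z) (y + realVec z) := by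
  refine ⟨add_realVec_mem_closedCell z h.1, fun u hu => ?_⟩
  have h1 := add_realVec_mem_closedCell (-z) hu
  have h2 : (fun i => k i + a i ⬝ᵥ z + a i ⬝ᵥ (-z)) = k := by
    funext i; rw [dotProduct_neg]; ring
  rw [h2] at h1
  have h3 := h.2 _ h1
  have h4 : realVec (-z) = -realVec z := by funext j; simp [realVec]
  rw [dotProduct_add, h4, dotProduct_neg] at h3
  rw [dotProduct_add]
  linarith

theorem index_eq_of_mem_openCell {A : Fin m → Fin n → ℝ} (hx : x ∈ OpenCell A β k)
    (hx' : x ∈ OpenCell A β k') : k = k' := by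
  funext i
  have h1 := hx i
  have h2 := hx' i
  have h3 : k i < k' i + 1 := by exact_mod_cast (by linarith : (k i : ℝ) < k' i + 1)
  have h4 : k' i < k i + 1 := by exact_mod_cast (by linarith : (k' i : ℝ) < k i + 1)
  omega

theorem torusProj_mem_hyp_iff {b : Fin m → AddCircle (1 : ℝ)}
    (hβ : ∀ i, (β i : AddCircle (1 : ℝ)) = b i) (i : Fin m) :
    torusProj x ∈ Hyp (a i) (b i) ↔ i ∈ Active (realVec ∘ a) β x := by
  rw [Hyp, mem_ofPred_eq, theta_torusProj, ← hβ, coe_eq_coe_iff_exists_add_int]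
  rfl

/-- The union of the regions whose lowest vertex with respect to `ℓ` is `p`. -/
def RegionAt (a : Fin m → Fin n → ℤ) (β : Fin m → ℝ) (ℓ : Fin n → ℝ) (p : Torus n) :
    Set (Torus n) :=
  ⋃ (k : Fin m → ℤ) (y : Fin n → ℝ) (_ : torusProj y = p ∧ MinAt (realVec ∘ a) β ℓ k y),
    torusProj '' OpenCell (realVec ∘ a) β k

theorem mem_regionAt {p q : Torus n} : q ∈ RegionAt a β ℓ p ↔
    ∃ k y x, torusProj y = p ∧ MinAt (realVec ∘ a) β ℓ k y ∧
      x ∈ OpenCell (realVec ∘ a) β k ∧ torusProj x = q := by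
  simp only [RegionAt, mem_iUnion, mem_image, exists_prop]
  exact ⟨fun ⟨k, y, ⟨h1, h2⟩, x, h3, h4⟩ => ⟨k, y, x, h1, h2, h3, h4⟩,
    fun ⟨k, y, x, h1, h2, h3, h4⟩ => ⟨k, y, ⟨h1, h2⟩, x, h3, h4⟩⟩

theorem isOpen_regionAt (p : Torus n) : IsOpen (RegionAt a β ℓ p) :=
  isOpen_iUnion fun _ => isOpen_iUnion fun _ => isOpen_iUnion fun _ =>
    isOpenMap_torusProj _ isOpen_openCell

theorem card_regions_eq_card_vertices {b : Fin m → AddCircle (1 : ℝ)}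
    (hspan : Submodule.span ℝ (Set.range (realVec ∘ a)) = ⊤)
    (hind : ∀ (p : Torus n) (S : Finset (Fin m)), (∀ i ∈ S, p ∈ Hyp (a i) (b i)) →
      LinearIndependent ℝ (fun i : S => realVec (a i))) :
    Nat.card (comps (Set.univ \ ⋃ i, Hyp (a i) (b i))) =
      Nat.card {p : Torus n |
        Submodule.span ℝ ((realVec ∘ a) '' {i | p ∈ Hyp (a i) (b i)}) = ⊤} := by
  choose β hβ using fun i => QuotientAddGroup.mk_surjective (b i)
  obtain ⟨ℓ, hgen⟩ := exists_generic_functional (realVec ∘ a)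
  have hind' : ∀ (y : Fin n → ℝ) (S : Finset (Fin m)),
      (S : Set (Fin m)) = Active (realVec ∘ a) β y →
      LinearIndependent ℝ (fun i : S => (realVec ∘ a) i) := fun y S hS =>
    hind (torusProj y) S fun i hi => (torusProj_mem_hyp_iff hβ i).2 (hS ▸ hi)
  have hactive : ∀ y : Fin n → ℝ,
      {i | torusProj y ∈ Hyp (a i) (b i)} = Active (realVec ∘ a) β y := fun y =>
    Set.ext fun i => torusProj_mem_hyp_iff hβ i
  have hdisj : ∀ p q, (RegionAt a β ℓ p ∩ RegionAt a β ℓ q).Nonempty → p = q := by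
    rintro p q ⟨r, hr, hr'⟩
    obtain ⟨k, y, x, rfl, hmin, hx, rfl⟩ := mem_regionAt.1 hr
    obtain ⟨k', y', x', rfl, hmin', hx', hxx'⟩ := mem_regionAt.1 hr'
    obtain ⟨z, rfl⟩ := exists_eq_add_of_torusProj_eq hxx'.symm
    have hk := index_eq_of_mem_openCell hx (add_realVec_mem_openCell z hx')
    subst hk
    rw [← hmin.point_unique hgen hind' (hmin'.add_realVec z), torusProj_add_realVec]
  have hpart : comps (Set.univ \ ⋃ i, Hyp (a i) (b i)) = RegionAt a β ℓ '' {p : Torus n |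
      Submodule.span ℝ ((realVec ∘ a) '' {i | p ∈ Hyp (a i) (b i)}) = ⊤} := by
    refine comps_eq_image_of_partition ?_ (fun p _ => isOpen_regionAt p) ?_ ?_
      fun p _ q _ => hdisj p q
    · ext q
      obtain ⟨x, rfl⟩ := surjective_torusProj q
      simp only [mem_sdiff, mem_univ, true_and, mem_iUnion, not_exists, exists_prop,
        mem_ofPred_eq]
      constructor
      · intro hx
        have hcell : x ∈ OpenCell (realVec ∘ a) β (fun i => ⌊(realVec ∘ a) i ⬝ᵥ x - β i⌋) := by
          intro i
          have h1 := Int.floor_le ((realVec ∘ a) i ⬝ᵥ x - β i)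
          have h2 := Int.lt_floor_add_one ((realVec ∘ a) i ⬝ᵥ x - β i)
          refine ⟨lt_of_le_of_ne (by linarith) fun h => hx i ?_, by linarith⟩
          exact (torusProj_mem_hyp_iff hβ i).2 ⟨_, h.symm⟩
        obtain ⟨y, hy⟩ := exists_minAt (ℓ := ℓ) hspan ⟨x, openCell_subset_closedCell hcell⟩
        refine ⟨torusProj y, ?_, mem_regionAt.2 ⟨_, y, x, rfl, hy, hcell, rfl⟩⟩
        rw [hactive]
        exact hy.span_active_eq_top hgen
      · rintro ⟨p, -, hp⟩ i hi
        obtain ⟨k, y, x', -, -, hx', hxx'⟩ := mem_regionAt.1 hp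
        rw [← hxx', torusProj_mem_hyp_iff hβ] at hi
        obtain ⟨j, hj⟩ := hi
        obtain ⟨h1, h2⟩ := hx' i
        rw [hj] at h1 h2
        have h3 : k i < j := by exact_mod_cast (by linarith : (k i : ℝ) < j)
        have h4 : j < k i + 1 := by exact_mod_cast (by linarith : (j : ℝ) < k i + 1)
        omega
    · intro p hp
      obtain ⟨y, rfl⟩ := surjective_torusProj p
      rw [mem_ofPred_eq, hactive] at hp
      obtain ⟨k, hk, -⟩ := exists_minAt_of_span_active hgen hind' hp
      have : RegionAt a β ℓ (torusProj y) = torusProj '' OpenCell (realVec ∘ a) β k := by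
        ext q
        constructor
        · intro hq
          obtain ⟨k', y', x', hy', hmin', hx', rfl⟩ := mem_regionAt.1 hq
          obtain ⟨z, rfl⟩ := exists_eq_add_of_torusProj_eq hy'.symm
          have hkk := hk.index_unique hgen hind' (hmin'.add_realVec z)
          subst hkk
          exact ⟨x' + realVec z, add_realVec_mem_openCell z hx', torusProj_add_realVec _ _⟩
        · rintro ⟨x, hx, rfl⟩
          exact mem_regionAt.2 ⟨k, y, x, rfl, hk, hx, rfl⟩
      rw [this]
      exact convex_openCell.isPreconnected.image _ continuous_torusProj.continuousOn
    · intro p hp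
      obtain ⟨y, rfl⟩ := surjective_torusProj p
      rw [mem_ofPred_eq, hactive] at hp
      obtain ⟨k, hk, x, hx⟩ := exists_minAt_of_span_active hgen hind' hp
      exact ⟨torusProj x, mem_regionAt.2 ⟨k, y, x, rfl, hk, hx, rfl⟩⟩
  rw [hpart]
  refine Nat.card_image_of_injOn fun p hp q hq hpq => hdisj p q ?_
  rw [← hpq, Set.inter_self]
  obtain ⟨y, rfl⟩ := surjective_torusProj p
  rw [mem_ofPred_eq, hactive] at hp
  obtain ⟨k, hk, x, hx⟩ := exists_minAt_of_span_active hgen hind' hp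
  exact ⟨torusProj x, mem_regionAt.2 ⟨k, y, x, rfl, hk, hx, rfl⟩⟩

end TorusLifts

section IntersectionPoset

variable {n m : ℕ} {a : Fin m → Fin n → ℤ} {b : Fin m → AddCircle (1 : ℝ)}

open scoped Matrix

theorem GenPos.linearIndependent_realVec (hgp : GenPos a b) (p : Torus n) (S : Finset (Fin m))
    (hp : ∀ i ∈ S, p ∈ Hyp (a i) (b i)) : LinearIndependent ℝ (fun i : S => realVec (a i)) := by
  have h := linearIndependent_algebraMap_comp_iff (S := ℝ).2
    (hgp S ⟨p, Set.mem_iInter₂.2 hp⟩)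
  have he : (fun i : S => realVec (a i)) =
      fun i : S => algebraMap ℚ ℝ ∘ fun j => (a i j : ℚ) := by
    funext i j
    simp [realVec]
  rw [he]
  exact h

theorem Spanning.span_range_realVec (h : Spanning a) :
    Submodule.span ℝ (Set.range (realVec ∘ a)) = ⊤ := by
  obtain ⟨S, hS, hli⟩ := h
  have h := linearIndependent_algebraMap_comp_iff (S := ℝ).2 hli
  have htop := h.span_eq_top_of_card_eq_finrank' (by simp [hS])
  rw [eq_top_iff, ← htop]
  refine Submodule.span_mono ?_
  rintro _ ⟨i, rfl⟩
  refine ⟨i, ?_⟩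
  funext j
  simp [realVec]

theorem span_image_eq_top_iff_card {S : Finset (Fin m)}
    (h : LinearIndependent ℝ (fun i : S => realVec (a i))) :
    Submodule.span ℝ ((realVec ∘ a) '' (S : Set (Fin m))) = ⊤ ↔ S.card = n := by
  have hr : (realVec ∘ a) '' (S : Set (Fin m)) = Set.range (fun i : S => realVec (a i)) := by
    ext v; simp
  rw [hr]
  constructor
  · intro htop
    have := finrank_span_eq_card h
    rw [htop, finrank_top, Module.finrank_fin_fun, Fintype.card_coe] at this
    exact this.symm
  · intro hc
    exact h.span_eq_top_of_card_eq_finrank' (by simp [hc])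

theorem subsingleton_of_subset_iInter_hyp {S : Finset (Fin m)} (hcard : S.card = n)
    (hS : LinearIndependent ℝ (fun i : S => realVec (a i))) {D : Set (Torus n)}
    (hD : IsPreconnected D) (hsub : ∀ i ∈ S, D ⊆ Hyp (a i) (b i)) : D.Subsingleton := by
  let e : Fin n ≃ S := (S.equivFinOfCardEq hcard).symm
  let M : Matrix (Fin n) (Fin n) ℤ := Matrix.of fun i => a (e i)
  have hdet : M.det ≠ 0 := by
    intro h0
    have hrows : LinearIndependent ℝ ((Int.castRingHom ℝ).mapMatrix M).row :=
      hS.comp e e.injective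
    rw [Matrix.linearIndependent_rows_iff_isUnit, Matrix.isUnit_iff_isUnit_det,
      ← RingHom.map_det, h0, map_zero] at hrows
    exact not_isUnit_zero hrows
  have hrow : ∀ x ∈ D, ∀ i, ∑ k, M i k • x k = b (e i) := fun x hx i => hsub _ (e i).2 hx
  have hmul : ∀ x : Torus n, ∀ j, M.det • x j = ∑ i, M.adjugate j i • ∑ k, M i k • x k := by
    intro x j
    have h1 : ∀ k, ∑ i, M.adjugate j i * M i k = if j = k then M.det else 0 := by
      intro k
      have := congrFun (congrFun M.adjugate_mul j) k
      rw [Matrix.mul_apply] at this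
      rw [this, Matrix.smul_apply, Matrix.one_apply]
      simp
    simp_rw [Finset.smul_sum, smul_smul]
    rw [Finset.sum_comm]
    simp_rw [← Finset.sum_smul, h1]
    simp
  intro x hx y hy
  funext j
  have hfin : {u : AddCircle (1 : ℝ) | M.det.natAbs • u = 0}.Finite :=
    AddCircle.finite_torsion 1 (Int.natAbs_pos.2 hdet)
  have himg : IsPreconnected ((fun z : Torus n => z j - y j) '' D) :=
    hD.image _ (by fun_prop)
  have hss := hfin.countable.isTotallyDisconnected _ (by
    rintro _ ⟨z, hz, rfl⟩
    rw [mem_ofPred_eq, natAbs_nsmul_eq_zero, smul_sub, hmul, hmul, sub_eq_zero]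
    simp_rw [hrow z hz, hrow y hy]) himg
  have := hss ⟨x, hx, rfl⟩ ⟨y, hy, rfl⟩
  exact sub_eq_zero.1 (this.trans (sub_self _))

theorem mem_LSet_iff {H : Fin m → Set (Torus n)} {C : Set (Torus n)} :
    C ∈ LSet H ↔ ∃ S : Finset (Fin m), ∃ x ∈ ⋂ i ∈ S, H i,
      C = connectedComponentIn (⋂ i ∈ S, H i) x := by
  constructor
  · rintro (rfl | ⟨S, -, x, hx, hC⟩)
    · refine ⟨∅, 0, by simp, ?_⟩
      simp [connectedComponentIn_univ]
    · exact ⟨S, x, hx, hC⟩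
  · rintro ⟨S, x, hx, rfl⟩
    rcases S.eq_empty_or_nonempty with rfl | hS
    · left
      simp [connectedComponentIn_univ]
    · exact Or.inr ⟨S, hS, x, hx, rfl⟩

theorem connectedComponentIn_subset_hyp_iff {p : Torus n} {I S : Finset (Fin m)}
    (hI : LinearIndependent ℝ (fun i : I => realVec (a i)))
    (hp : ∀ i, i ∈ I ↔ p ∈ Hyp (a i) (b i)) (hSI : S ⊆ I) (i : Fin m) :
    connectedComponentIn (⋂ j ∈ S, Hyp (a j) (b j)) p ⊆ Hyp (a i) (b i) ↔ i ∈ S := by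
  classical
  have hpS : p ∈ ⋂ j ∈ S, Hyp (a j) (b j) := Set.mem_iInter₂.2 fun j hj => (hp j).1 (hSI hj)
  constructor
  · intro hsub
    by_contra hiS
    have hpi := hsub (mem_connectedComponentIn hpS)
    obtain ⟨w, hw⟩ := exists_dotProduct_eq (A := realVec ∘ a) hI (Pi.single i 1)
    let f : ℝ → Torus n := fun t => p + torusProj (t • w)
    have hf : Continuous f := by
      have : Continuous fun t : ℝ => torusProj (t • w) :=
        continuous_torusProj.comp (by fun_prop)
      exact continuous_const.add this
    have hθ : ∀ t j, theta (a j) (f t) =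
        theta (a j) p + ((t * (realVec (a j) ⬝ᵥ w) : ℝ) : AddCircle (1 : ℝ)) := by
      intro t j
      rw [theta_add, theta_torusProj, dotProduct_smul, smul_eq_mul]
    have hrange : Set.range f ⊆ ⋂ j ∈ S, Hyp (a j) (b j) := by
      rintro _ ⟨t, rfl⟩
      refine Set.mem_iInter₂.2 fun j hj => ?_
      have hji : j ≠ i := fun h => hiS (h ▸ hj)
      have h0 : realVec (a j) ⬝ᵥ w = 0 := by
        have := hw j (hSI hj)
        rwa [Pi.single_eq_of_ne hji] at this
      rw [Hyp, mem_ofPred_eq, hθ, h0, mul_zero, AddCircle.coe_zero, add_zero]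
      exact (hp j).1 (hSI hj)
    have hpr : p ∈ Set.range f := ⟨0, by
      have : torusProj (0 : Fin n → ℝ) = 0 := funext fun _ => AddCircle.coe_zero 1
      simp only [f, zero_smul, this, add_zero]⟩
    have hmem := hsub ((isPreconnected_range hf).subset_connectedComponentIn hpr hrange
      ⟨1 / 2, rfl⟩)
    have h1 : realVec (a i) ⬝ᵥ w = 1 := by
      have := hw i ((hp i).2 hpi)
      rwa [Pi.single_eq_same] at this
    rw [Hyp, mem_ofPred_eq, hθ, h1, show theta (a i) p = b i from hpi, add_eq_left,
      ← AddCircle.coe_zero, coe_eq_coe_iff_exists_add_int] at hmem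
    obtain ⟨z, hz⟩ := hmem
    have h2 : (2 * z : ℝ) = 1 := by linarith
    have h3 : 2 * z = 1 := by exact_mod_cast h2
    omega
  · intro hi
    exact (connectedComponentIn_subset _ _).trans (Set.biInter_subset_of_mem hi)

theorem mu_connectedComponentIn_eq {p : Torus n} {I : Finset (Fin m)}
    (hI : LinearIndependent ℝ (fun i : I => realVec (a i)))
    (hp : ∀ i, i ∈ I ↔ p ∈ Hyp (a i) (b i)) (hproper : ∀ i, Hyp (a i) (b i) ≠ Set.univ)
    {μ : Set (Torus n) → ℤ}
    (hμ : ∀ x ∈ LSet (fun i => Hyp (a i) (b i)),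
      (∑ᶠ z ∈ {z | z ∈ LSet (fun i => Hyp (a i) (b i)) ∧ x ⊆ z}, μ z) =
        open Classical in if x = Set.univ then 1 else 0)
    (S : Finset (Fin m)) (hSI : S ⊆ I) :
    μ (connectedComponentIn (⋂ j ∈ S, Hyp (a j) (b j)) p) = (-1) ^ S.card := by
  classical
  let comp : Finset (Fin m) → Set (Torus n) :=
    fun S => connectedComponentIn (⋂ j ∈ S, Hyp (a j) (b j)) p
  have hiff : ∀ S ⊆ I, ∀ i, comp S ⊆ Hyp (a i) (b i) ↔ i ∈ S :=
    fun S hS i => connectedComponentIn_subset_hyp_iff hI hp hS i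
  have hpS : ∀ S ⊆ I, p ∈ ⋂ j ∈ S, Hyp (a j) (b j) :=
    fun S hS => Set.mem_iInter₂.2 fun j hj => (hp j).1 (hS hj)
  have hsum : ∀ S ⊆ I, ∑ T ∈ S.powerset, μ (comp T) = if S = ∅ then 1 else 0 := by
    intro S hS
    have hL : comp S ∈ LSet (fun i => Hyp (a i) (b i)) := mem_LSet_iff.2 ⟨S, p, hpS S hS, rfl⟩
    have huniv : comp S = Set.univ ↔ S = ∅ := by
      constructor
      · intro h
        by_contra hne
        obtain ⟨i, hi⟩ := Finset.nonempty_of_ne_empty hne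
        exact hproper i (Set.univ_subset_iff.1 (h ▸ (hiff S hS i).2 hi))
      · rintro rfl
        simp [comp, connectedComponentIn_univ]
    have hset : {z | z ∈ LSet (fun i => Hyp (a i) (b i)) ∧ comp S ⊆ z} =
        comp '' (S.powerset : Set (Finset (Fin m))) := by
      ext z
      constructor
      · rintro ⟨hz, hSz⟩
        obtain ⟨T, x, hx, rfl⟩ := mem_LSet_iff.1 hz
        have hpz := hSz (mem_connectedComponentIn (hpS S hS))
        refine ⟨T, ?_, (connectedComponentIn_eq hpz).symm⟩
        rw [Finset.mem_coe, Finset.mem_powerset]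
        intro i hi
        refine (hiff S hS i).1 (hSz.trans ?_)
        exact (connectedComponentIn_subset _ _).trans (Set.biInter_subset_of_mem hi)
      · rintro ⟨T, hT, rfl⟩
        rw [Finset.mem_coe, Finset.mem_powerset] at hT
        refine ⟨mem_LSet_iff.2 ⟨T, p, hpS T (hT.trans hS), rfl⟩, ?_⟩
        exact connectedComponentIn_mono _ (Set.biInter_subset_biInter_left hT)
    have hinj : Set.InjOn comp (S.powerset : Set (Finset (Fin m))) := by
      intro T hT T' hT' h
      rw [Finset.mem_coe, Finset.mem_powerset] at hT hT'
      ext i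
      rw [← hiff T (hT.trans hS), ← hiff T' (hT'.trans hS), h]
    have := hμ _ hL
    rw [hset, finsum_mem_image hinj, finsum_mem_coe_finset] at this
    rw [this]
    exact if_congr huniv rfl rfl
  induction S using Finset.strongInduction with
  | H S ih =>
    have h1 := hsum S hSI
    rw [← Finset.sum_powerset_neg_one_pow_card,
      ← Finset.add_sum_erase _ _ (Finset.mem_powerset_self S),
      ← Finset.add_sum_erase _ _ (Finset.mem_powerset_self S)] at h1
    have h2 : ∑ T ∈ S.powerset.erase S, μ (comp T) =
        ∑ T ∈ S.powerset.erase S, (-1 : ℤ) ^ T.card := by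
      refine Finset.sum_congr rfl fun T hT => ?_
      rw [Finset.mem_erase, Finset.mem_powerset] at hT
      exact ih T (hT.2.ssubset_of_ne hT.1) (hT.2.trans hSI)
    rw [h2] at h1
    exact add_right_cancel h1

theorem hyp_ne_univ {v : Fin n → ℤ} (hv : v ≠ 0) (c : AddCircle (1 : ℝ)) :
    Hyp v c ≠ Set.univ := by
  intro h
  have hpos : 0 < realVec v ⬝ᵥ realVec v := by
    refine lt_of_le_of_ne (Finset.sum_nonneg fun _ _ => mul_self_nonneg _) fun h0 => hv ?_
    have := dotProduct_self_eq_zero.1 h0.symm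
    funext j
    exact Int.cast_eq_zero.1 (congrFun this j)
  have h0 : torusProj (0 : Fin n → ℝ) ∈ Hyp v c := h ▸ Set.mem_univ _
  have h1 : torusProj ((1 / (2 * (realVec v ⬝ᵥ realVec v))) • realVec v) ∈ Hyp v c :=
    h ▸ Set.mem_univ _
  rw [Hyp, mem_ofPred_eq, theta_torusProj] at h0 h1
  rw [← h0, coe_eq_coe_iff_exists_add_int, dotProduct_smul, smul_eq_mul, dotProduct_zero] at h1
  obtain ⟨z, hz⟩ := h1
  have h2 : (2 * z : ℝ) = 1 := by
    field_simp at hz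
    linarith
  have h3 : 2 * z = 1 := by exact_mod_cast h2
  omega

theorem SigIn_univ_self (ha : ∀ i, a i ≠ 0) :
    SigIn Set.univ n (fun i => Hyp (a i) (b i)) n =
      comps (Set.univ \ ⋃ i, Hyp (a i) (b i)) := by
  unfold SigIn
  rw [Nat.strongRecOn_eq]
  rcases Nat.eq_zero_or_pos n with rfl | hn
  · have : IsEmpty (Fin m) := ⟨fun i => ha i (Subsingleton.elim _ _)⟩
    rw [if_pos rfl]
    congr 1
    simp
  · rw [if_neg hn.ne', if_pos rfl]

end IntersectionPoset

open scoped Classical in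
/-- Toric analogue of Zaslavsky's theorem: for a spanning toric hyperplane arrangement in
general position with at least `n` hyperplanes, with Möbius function `μ` of its (finite)
intersection poset `L(A)` and characteristic polynomial
`χ_A(t) = Σ_{x ∈ L(A)} μ(Tⁿ, x) t^{dim x}` (where `dim x = n − |{i : x ⊆ Hᵢ}|`), the
number of regions satisfies `f_n(A) = (−1)ⁿ χ_A(0)`. -/
theorem card_regions_eq_char_poly_at_zero {n m : ℕ}
    (a : Fin m → Fin n → ℤ) (b : Fin m → AddCircle (1 : ℝ))
    (ha : ∀ i, a i ≠ 0) (hm : n ≤ m) (hspan : Spanning a) (hgp : GenPos a b)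
    (hfin : (LSet (fun i => Hyp (a i) (b i))).Finite)
    (μ : Set (Torus n) → ℤ)
    (hμ : ∀ x ∈ LSet (fun i => Hyp (a i) (b i)),
      (∑ᶠ z ∈ {z | z ∈ LSet (fun i => Hyp (a i) (b i)) ∧ x ⊆ z}, μ z) =
        if x = Set.univ then 1 else 0) :
    (Nat.card ↥(SigIn Set.univ n (fun i => Hyp (a i) (b i)) n) : ℤ) =
      (-1 : ℤ) ^ n *
        ∑ᶠ x ∈ LSet (fun i => Hyp (a i) (b i)),
          μ x * (0 : ℤ) ^ (n - Nat.card {i : Fin m // x ⊆ Hyp (a i) (b i)}) := by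
  have hind := hgp.linearIndependent_realVec
  rw [SigIn_univ_self ha, card_regions_eq_card_vertices hspan.span_range_realVec hind]
  set L := LSet (fun i => Hyp (a i) (b i)) with hL
  set V : Set (Torus n) := {p : Torus n |
    Submodule.span ℝ ((realVec ∘ a) '' {i | p ∈ Hyp (a i) (b i)}) = ⊤} with hV
  have hvertex : ∀ p : Torus n, p ∈ V ↔
      (Finset.univ.filter fun i => p ∈ Hyp (a i) (b i)).card = n := by
    intro p
    rw [← span_image_eq_top_iff_card (a := a) (hind p _ fun i hi => (Finset.mem_filter.1 hi).2)]
    simp [hV]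
  have hfiber : ∀ p ∈ V, connectedComponentIn
      (⋂ j ∈ Finset.univ.filter fun i => p ∈ Hyp (a i) (b i), Hyp (a j) (b j)) p = {p} := by
    intro p hp
    have hmem : p ∈ ⋂ j ∈ Finset.univ.filter fun i => p ∈ Hyp (a i) (b i), Hyp (a j) (b j) :=
      Set.mem_iInter₂.2 fun i hi => (Finset.mem_filter.1 hi).2
    refine Set.Subsingleton.eq_singleton_of_mem ?_ (mem_connectedComponentIn hmem)
    exact subsingleton_of_subset_iInter_hyp ((hvertex p).1 hp)
      (hind p _ fun i hi => (Finset.mem_filter.1 hi).2) isPreconnected_connectedComponentIn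
      fun i hi => (connectedComponentIn_subset _ _).trans (Set.biInter_subset_of_mem hi)
  have hVL : (fun p => ({p} : Set (Torus n))) '' V ⊆ L := by
    rintro _ ⟨p, hp, rfl⟩
    exact mem_LSet_iff.2 ⟨_, p, Set.mem_iInter₂.2 fun i hi => (Finset.mem_filter.1 hi).2,
      (hfiber p hp).symm⟩
  have hval : ∀ x ∈ L, μ x * (0 : ℤ) ^ (n - Nat.card {i : Fin m // x ⊆ Hyp (a i) (b i)}) =
      if x ∈ (fun p => ({p} : Set (Torus n))) '' V then (-1) ^ n else 0 := by
    intro x hx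
    have hcard : Nat.card {i : Fin m // x ⊆ Hyp (a i) (b i)} =
        (Finset.univ.filter fun i => x ⊆ Hyp (a i) (b i)).card := by
      rw [Nat.card_eq_fintype_card, Fintype.card_subtype]
    rw [hcard]
    split_ifs with hxV
    · obtain ⟨p, hp, rfl⟩ := hxV
      have hmu := mu_connectedComponentIn_eq (p := p)
        (I := Finset.univ.filter fun i => p ∈ Hyp (a i) (b i)) (hind p _ fun i hi => (Finset.mem_filter.1 hi).2) (fun i => by simp)
        (fun i => hyp_ne_univ (ha i) (b i)) hμ _ (Finset.Subset.refl _)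
      rw [hfiber p hp, (hvertex p).1 hp] at hmu
      simp only [Set.singleton_subset_iff]
      rw [(hvertex p).1 hp, hmu, Nat.sub_self, pow_zero, mul_one]
    · rw [zero_pow, mul_zero]
      intro h0
      obtain ⟨S, p, hp, rfl⟩ := mem_LSet_iff.1 hx
      have hpx := mem_connectedComponentIn hp
      set x := connectedComponentIn (⋂ i ∈ S, Hyp (a i) (b i)) p
      have hli := hind p (Finset.univ.filter fun i => x ⊆ Hyp (a i) (b i))
        fun i hi => (Finset.mem_filter.1 hi).2 hpx
      have hle := hli.fintype_card_le_finrank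
      rw [Module.finrank_fin_fun, Fintype.card_coe] at hle
      have heq : (Finset.univ.filter fun i => x ⊆ Hyp (a i) (b i)).card = n := by omega
      have hss : x.Subsingleton := subsingleton_of_subset_iInter_hyp heq hli
        isPreconnected_connectedComponentIn fun i hi => (Finset.mem_filter.1 hi).2
      refine hxV ⟨p, ?_, (hss.eq_singleton_of_mem hpx).symm⟩
      rw [hV, mem_ofPred_eq, eq_top_iff, ← (span_image_eq_top_iff_card hli).2 heq]
      exact Submodule.span_mono (Set.image_mono fun i hi =>
        (Finset.mem_filter.1 (Finset.mem_coe.1 hi)).2 hpx)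
  have hcardV : Nat.card V = (hfin.subset hVL).toFinset.card := by
    rw [← Set.ncard_eq_toFinset_card _ (hfin.subset hVL), Set.ncard_image_of_injective _ Set.singleton_injective]
    rfl
  rw [finsum_mem_congr rfl hval, finsum_mem_eq_finite_toFinset_sum _ hfin, ← Finset.sum_filter,
    Finset.sum_const, hcardV]
  have hfilter : (hfin.toFinset.filter fun x => x ∈ (fun p => ({p} : Set (Torus n))) '' V) =
      (hfin.subset hVL).toFinset := by
    ext x
    simp only [Finset.mem_filter, Set.Finite.mem_toFinset]
    exact ⟨fun h => h.2, fun h => ⟨hVL h, h⟩⟩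
  rw [hfilter, nsmul_eq_mul, mul_left_comm, ← mul_pow]
  simp
end
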